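/- Assume hypotheses (D), (M), (I). Let T>0, r>0, and let {ε_m}⊂[0,1/5] decrease to ε₀∈[0,1/5]. Let t₀∈ℝ and let {u₀^m}⊂C_γ with ‖u₀^m‖_γ ≤ r converge in C_γ to u₀. Then for any sequence {u^{ε_m}} where each u^{ε_m} is a solution of the ε_m-inflated differential inclusion on [t₀,t₀+T] with initial datum u₀^m at t₀, there is a subsequence {u^{ε_{m_k}}} converging uniformly on [t₀,t₀+T] to a continuous function u*:[t₀,t₀+T]→ℝ^{n²}, and the function equal to u₀(·−t₀) on (−∞,t₀] and to u* on [t₀,t₀+T] is a solution of the ε₀-inflated differential inclusion on [t₀,t₀+T] with initial datum u₀ at t₀. -/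

import Mathlib

open MeasureTheory Set Filter Topology Pointwise

noncomputable section

/-- Index set for the synaptic variables `z i j`, `i ≠ j`. -/
abbrev IdxZ (n : ℕ) := {p : Fin n × Fin n // p.1 ≠ p.2}

/-- The state space `ℝ^{n²} = ℝ^n × ℝ^{n(n-1)}`, with the norm
`‖(x,z)‖ = max (‖x‖_∞) (‖z‖_∞)` (product of supremum norms). -/
abbrev NState (n : ℕ) := (Fin n → ℝ) × (IdxZ n → ℝ)

/-- The `C_γ` norm: `‖u‖_γ = sup_{t ≤ 0} e^{γ t} ‖u t‖`. -/
def gNorm (γ : ℝ) {E : Type*} [NormedAddCommGroup E] (u : ℝ → E) : ℝ :=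
  ⨆ t : Iic (0 : ℝ), Real.exp (γ * t.1) * ‖u t.1‖

/-- Membership in `C_γ`: continuity on `(-∞,0]`, existence of a finite limit of
`e^{γ t} u t` as `t → -∞`, and boundedness of `e^{γ t} ‖u t‖` on `(-∞,0]`. -/
def InC (γ : ℝ) {E : Type*} [NormedAddCommGroup E] [NormedSpace ℝ E] (u : ℝ → E) : Prop :=
  ContinuousOn u (Iic 0) ∧
    (∃ L : E, Tendsto (fun t => Real.exp (γ * t) • u t) atBot (𝓝 L)) ∧
    BddAbove (range fun t : Iic (0 : ℝ) => Real.exp (γ * t.1) * ‖u t.1‖)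

/-- The history `u_t(s) = u (t+s)`. -/
def hist {E : Type*} (u : ℝ → E) (t : ℝ) : ℝ → E := fun s => u (t + s)

/-- The sigmoidal function `σ_ε (s) = 1/(1+e^{-s/ε})`. -/
def sigm (ε s : ℝ) : ℝ := 1 / (1 + Real.exp (-s / ε))

/-- Hypothesis (D): `A i`, `B p` locally Lipschitz and bounded below by `α > 0`. -/
def HypD {n : ℕ} (α : ℝ) (A : Fin n → ℝ → ℝ) (B : IdxZ n → ℝ → ℝ) : Prop :=
  0 < α ∧ (∀ i, LocallyLipschitz (A i) ∧ ∀ s, α ≤ A i s) ∧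
    ∀ p, LocallyLipschitz (B p) ∧ ∀ s, α ≤ B p s

/-- Hypothesis (M): `∫_{-∞}^0 e^{-γ t} dμ_p (t) < ∞`. -/
def HypM {n : ℕ} (γ : ℝ) (μ : IdxZ n → Measure ℝ) : Prop :=
  ∀ p, ∫⁻ t in Iic (0 : ℝ), ENNReal.ofReal (Real.exp (-γ * t)) ∂(μ p) < ⊤

/-- Hypothesis (I): continuity of the external stimuli. -/
def HypI {n : ℕ} (Istim : Fin n → ℝ → ℝ) : Prop := ∀ i, Continuous (Istim i)

/-- Decay term `D`. -/
def decayT {n : ℕ} (A : Fin n → ℝ → ℝ) (B : IdxZ n → ℝ → ℝ) (u : ℝ → NState n) : NState n :=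
  (fun i => -(A i ((u 0).1 i)) * (u 0).1 i, fun p => -(B p ((u 0).2 p)) * (u 0).2 p)

/-- Sigmoidal excitation and inhibition term `Σ^ε`. -/
def sigTerm {n : ℕ} (ε : ℝ) (μ : IdxZ n → Measure ℝ) (c d : IdxZ n → ℝ)
    (Γ : Fin n → ℝ) (u : ℝ → NState n) : NState n :=
  (fun i => ∑ k : Fin n,
      if h : k ≠ i then
        ((u 0).2 ⟨(k, i), h⟩ - c ⟨(k, i), h⟩) *
          ∫ τ in Iic (0 : ℝ), sigm ε ((u τ).1 k - Γ k) ∂(μ ⟨(k, i), h⟩)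
      else 0,
    fun p =>
      d p * (∫ τ in Iic (0 : ℝ), sigm ε ((u τ).1 p.1.1 - Γ p.1.1) ∂(μ p)) *
        max ((u 0).1 p.1.2) 0)

/-- Stimulus term `I(t) = ((I_i(t))_i, 0)`. -/
def stimT {n : ℕ} (Istim : Fin n → ℝ → ℝ) (t : ℝ) : NState n :=
  (fun i => Istim i t, 0)

/-- Right-hand side `f_ε(t,u) = D(u) + Σ^ε(u) + I(t)` of the sigmoidal system. -/
def fEps {n : ℕ} (ε : ℝ) (A : Fin n → ℝ → ℝ) (B : IdxZ n → ℝ → ℝ)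
    (μ : IdxZ n → Measure ℝ) (c d : IdxZ n → ℝ) (Γ : Fin n → ℝ)
    (Istim : Fin n → ℝ → ℝ) (t : ℝ) (u : ℝ → NState n) : NState n :=
  decayT A B u + sigTerm ε μ c d Γ u + stimT Istim t

/-- Solution of the sigmoidal system on `[t₀, t₁)` with initial datum `u₀` at `t₀`. -/
def IsSigSolOn {n : ℕ} (ε : ℝ) (A : Fin n → ℝ → ℝ) (B : IdxZ n → ℝ → ℝ)
    (μ : IdxZ n → Measure ℝ) (c d : IdxZ n → ℝ) (Γ : Fin n → ℝ)
    (Istim : Fin n → ℝ → ℝ) (t₀ t₁ : ℝ) (u₀ u : ℝ → NState n) : Prop :=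
  (∀ s ≤ (0 : ℝ), u (t₀ + s) = u₀ s) ∧ ContinuousOn u (Iio t₁) ∧
    ∀ t ∈ Ico t₀ t₁, HasDerivAt u (fEps ε A B μ c d Γ Istim t (hist u t)) t

/-- Solution of the sigmoidal system on the closed interval `[t₀, t₁]`. -/
def IsSigSolOnC {n : ℕ} (ε : ℝ) (A : Fin n → ℝ → ℝ) (B : IdxZ n → ℝ → ℝ)
    (μ : IdxZ n → Measure ℝ) (c d : IdxZ n → ℝ) (Γ : Fin n → ℝ)
    (Istim : Fin n → ℝ → ℝ) (t₀ t₁ : ℝ) (u₀ u : ℝ → NState n) : Prop :=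
  (∀ s ≤ (0 : ℝ), u (t₀ + s) = u₀ s) ∧ ContinuousOn u (Iic t₁) ∧
    ∀ t ∈ Ico t₀ t₁, HasDerivAt u (fEps ε A B μ c d Γ Istim t (hist u t)) t

/-- `b(ε) = ε log((1-ε)/ε)` for `ε ≠ 0`, `b(0) = 0`. -/
def bfun (ε : ℝ) : ℝ := if ε = 0 then 0 else ε * Real.log ((1 - ε) / ε)

/-- The set-valued function `χ_ε`. -/
def chiSet (ε s : ℝ) : Set ℝ :=
  if s < -bfun ε then Icc 0 ε else if s ≤ bfun ε then Icc 0 1 else Icc (1 - ε) 1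

/-- Aumann integral over `(-∞,0]` of a set-valued map `F` with respect to `μ`:
the set of integrals of integrable measurable selectors of `F`. -/
def aumann (F : ℝ → Set ℝ) (μ : Measure ℝ) : Set ℝ :=
  {y | ∃ s : ℝ → ℝ, Measurable s ∧ IntegrableOn s (Iic 0) μ ∧
      (∀ t ≤ (0 : ℝ), s t ∈ F t) ∧ y = ∫ t in Iic (0 : ℝ), s t ∂μ}

/-- Directed Hausdorff pseudometric `haus(A,B) = sup_{a∈A} inf_{b∈B} |a-b|`. -/
def hausd (S T : Set ℝ) : ℝ :=
  sSup ((fun a => sInf ((fun b => |a - b|) '' T)) '' S)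

/-- The `i`-th factor of `X^ε(u)`: the Minkowski sum over `k ≠ i` of
`(z_{ki}(0) - c_{ki}) • ∫ χ_ε(x_k(τ)-Γ_k) dμ_{ki}(τ)`. -/
def XsetX {n : ℕ} (ε : ℝ) (μ : IdxZ n → Measure ℝ) (c : IdxZ n → ℝ)
    (Γ : Fin n → ℝ) (u : ℝ → NState n) (i : Fin n) : Set ℝ :=
  {y | ∃ g : Fin n → ℝ, g i = 0 ∧
      (∀ k, ∀ h : k ≠ i,
        g k ∈ ((u 0).2 ⟨(k, i), h⟩ - c ⟨(k, i), h⟩) •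
          aumann (fun τ => chiSet ε ((u τ).1 k - Γ k)) (μ ⟨(k, i), h⟩)) ∧
      y = ∑ k, g k}

/-- The set-valued map `X^ε : C_γ → 𝒫(ℝ^{n²})`. -/
def Xset {n : ℕ} (ε : ℝ) (μ : IdxZ n → Measure ℝ) (c d : IdxZ n → ℝ)
    (Γ : Fin n → ℝ) (u : ℝ → NState n) : Set (NState n) :=
  {v | (∀ i, v.1 i ∈ XsetX ε μ c Γ u i) ∧
      ∀ p : IdxZ n, v.2 p ∈ (d p * max ((u 0).1 p.1.2) 0) •
        aumann (fun τ => chiSet ε ((u τ).1 p.1.1 - Γ p.1.1)) (μ p)}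

/-- Solution of the `ε`-inflated differential inclusion on `[t₀,t₁]` with initial
datum `u₀` at `t₀`: absolutely continuous on `[t₀,t₁]` (expressed in integral form)
with `u'(t) = D(u_t) + Σ(t) + I(t)` a.e. for some integrable selector `Σ(t) ∈ X^ε(u_t)`. -/
def IsIncSolOn {n : ℕ} (ε : ℝ) (A : Fin n → ℝ → ℝ) (B : IdxZ n → ℝ → ℝ)
    (μ : IdxZ n → Measure ℝ) (c d : IdxZ n → ℝ) (Γ : Fin n → ℝ)
    (Istim : Fin n → ℝ → ℝ) (t₀ t₁ : ℝ) (u₀ u : ℝ → NState n) : Prop :=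
  (∀ s ≤ (0 : ℝ), u (t₀ + s) = u₀ s) ∧ ContinuousOn u (Icc t₀ t₁) ∧
    ∃ S : ℝ → NState n,
      (∀ t ∈ Icc t₀ t₁, S t ∈ Xset ε μ c d Γ (hist u t)) ∧
      IntegrableOn (fun s => decayT A B (hist u s) + S s + stimT Istim s) (Icc t₀ t₁) ∧
      ∀ t ∈ Icc t₀ t₁,
        u t = u₀ 0 + ∫ s in t₀..t, (decayT A B (hist u s) + S s + stimT Istim s)

/-- Clamped history: the canonical representative in `C_γ` of the history `u_t`. -/
def clampHist {n : ℕ} (u : ℝ → NState n) (t : ℝ) : ℝ → NState n :=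
  fun s => u (t + min s 0)

/-- Attainability set `Φ^ε(t, t₀, u₀)` of the `ε`-inflated inclusion. -/
def attain {n : ℕ} (ε : ℝ) (A : Fin n → ℝ → ℝ) (B : IdxZ n → ℝ → ℝ)
    (μ : IdxZ n → Measure ℝ) (c d : IdxZ n → ℝ) (Γ : Fin n → ℝ)
    (Istim : Fin n → ℝ → ℝ) (t t₀ : ℝ) (u₀ : ℝ → NState n) : Set (ℝ → NState n) :=
  {v | ∃ u, IsIncSolOn ε A B μ c d Γ Istim t₀ t u₀ u ∧ v = clampHist u t}

/-- Total mass `|μ_p|` of the measure `μ_p` on `(-∞,0]`. -/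
def mTot {n : ℕ} (μ : IdxZ n → Measure ℝ) (p : IdxZ n) : ℝ := (μ p (Iic 0)).toReal

/-- Hypothesis (A). -/
def HypA {n : ℕ} (α : ℝ) (μ : IdxZ n → Measure ℝ) (d : IdxZ n → ℝ) : Prop :=
  ∃ lx lz nx nz eta eps : IdxZ n → ℝ,
    (∀ p, lx p ∈ ({1, mTot μ p ^ 2, d p ^ 2, mTot μ p ^ 2 * d p ^ 2} : Set ℝ) ∧
        lz p ∈ ({1, mTot μ p ^ 2, d p ^ 2, mTot μ p ^ 2 * d p ^ 2} : Set ℝ) ∧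
        lx p * lz p = mTot μ p ^ 2 * d p ^ 2 ∧
        nx p ∈ ({1, mTot μ p ^ 2} : Set ℝ) ∧ nz p ∈ ({1, mTot μ p ^ 2} : Set ℝ) ∧
        nx p * nz p = mTot μ p ^ 2 ∧ 0 < eta p ∧ 0 < eps p ∧
        nz p / eta p + lz p / eps p < 2 * α) ∧
    ∀ i : Fin n,
      (∑ k : Fin n, if h : k ≠ i then
          nx ⟨(k, i), h⟩ * eta ⟨(k, i), h⟩ + lx ⟨(k, i), h⟩ * eps ⟨(k, i), h⟩
        else 0) < 2 * α

/-- Directed Hausdorff "distance" between subsets of `C_γ`, w.r.t. `‖·‖_γ`. -/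
def setDistG (γ : ℝ) {n : ℕ} (S T : Set (ℝ → NState n)) : ℝ :=
  sSup ((fun a => sInf ((fun b => gNorm γ (fun s => a s - b s)) '' T)) '' S)


theorem core_up {a b : ℝ} (S hi : ℕ → ℝ → ℝ) (hi0 v : ℝ → ℝ) (K : ℝ)
    (hS : ∀ m, IntegrableOn (S m) (Icc a b))
    (hSb : ∀ m, ∀ t ∈ Icc a b, S m t ≤ hi m t)
    (mhi : ∀ m, Measurable (hi m)) (mhi0 : Measurable hi0)
    (bhi : ∀ m, ∀ t ∈ Icc a b, |hi m t| ≤ K) (bhi0 : ∀ t ∈ Icc a b, |hi0 t| ≤ K)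
    (hlim : ∀ t ∈ Icc a b, Tendsto (fun m => max (hi m t - hi0 t) 0) atTop (𝓝 0))
    (hv : ∀ t ∈ Icc a b, Tendsto (fun m => ∫ s in a..t, S m s) atTop (𝓝 (v t)))
    {s t : ℝ} (hs : s ∈ Icc a b) (ht : t ∈ Icc a b) (hst : s ≤ t) :
    v t - v s ≤ ∫ x in s..t, hi0 x := by
  have hsub : ∀ {p q : ℝ}, p ∈ Icc a b → q ∈ Icc a b → uIcc p q ⊆ Icc a b :=
    fun hp hq => (convex_Icc a b).ordConnected.uIcc_subset hp hq
  have haI : a ∈ Icc a b := ⟨le_rfl, hs.1.trans hs.2⟩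
  have iS : ∀ m, ∀ {p q : ℝ}, p ∈ Icc a b → q ∈ Icc a b →
      IntervalIntegrable (S m) volume p q := fun m p q hp hq =>
    ((hS m).mono_set (hsub hp hq)).intervalIntegrable
  have iB : ∀ (g : ℝ → ℝ) (C : ℝ), Measurable g → (∀ t ∈ Icc a b, |g t| ≤ C) →
      IntegrableOn g (Icc a b) := by
    intro g C mg bg
    refine Measure.integrableOn_of_bounded (M := C) (by simp) mg.aestronglyMeasurable ?_
    filter_upwards [ae_restrict_mem measurableSet_Icc] with x hx using bg x hx
  have iB' : ∀ (g : ℝ → ℝ) (C : ℝ), Measurable g → (∀ t ∈ Icc a b, |g t| ≤ C) →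
      IntervalIntegrable g volume s t := fun g C mg bg =>
    ((iB g C mg bg).mono_set (hsub hs ht)).intervalIntegrable
  have bmax : ∀ m, ∀ t ∈ Icc a b, |max (hi m t - hi0 t) 0| ≤ 2 * K := by
    intro m t ht
    have h1 := abs_le.1 (bhi m t ht)
    have h2 := abs_le.1 (bhi0 t ht)
    rw [abs_of_nonneg (le_max_right _ _)]
    exact max_le (by linarith) (by linarith)
  have h1 : Tendsto (fun m => ∫ x in s..t, S m x) atTop (𝓝 (v t - v s)) := by
    refine ((hv t ht).sub (hv s hs)).congr fun m => ?_
    exact intervalIntegral.integral_interval_sub_left (iS m haI ht) (iS m haI hs)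
  have h2 : Tendsto (fun m => ∫ x in s..t, max (hi m x - hi0 x) 0) atTop (𝓝 0) := by
    have := intervalIntegral.tendsto_integral_filter_of_dominated_convergence
      (F := fun m x => max (hi m x - hi0 x) 0) (f := fun _ => (0:ℝ)) (μ := volume) (a := s) (b := t)
      (l := atTop) (fun _ => 2 * K) ?_ ?_ ?_ ?_
    · simpa using this
    · exact Eventually.of_forall fun m =>
        (((mhi m).sub mhi0).max measurable_const).aestronglyMeasurable
    · refine Eventually.of_forall fun m => Eventually.of_forall fun x hx => ?_
      exact bmax m x (hsub hs ht (uIoc_subset_uIcc hx))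
    · exact intervalIntegrable_const
    · exact Eventually.of_forall fun x hx => hlim x (hsub hs ht (uIoc_subset_uIcc hx))
  have h3 : Tendsto (fun m => (∫ x in s..t, hi0 x) + ∫ x in s..t, max (hi m x - hi0 x) 0) atTop
      (𝓝 ((∫ x in s..t, hi0 x) + 0)) := tendsto_const_nhds.add h2
  rw [add_zero] at h3
  refine le_of_tendsto_of_tendsto' h1 h3 fun m => ?_
  have j1 := iB' hi0 K mhi0 bhi0
  have j2 := iB' (fun x => max (hi m x - hi0 x) 0) (2 * K)
    (((mhi m).sub mhi0).max measurable_const) (bmax m)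
  rw [← intervalIntegral.integral_add j1 j2]
  refine intervalIntegral.integral_mono_on hst (iS m hs ht) (j1.add j2) fun x hx => ?_
  have := hSb m x (hsub hs ht (by rwa [uIcc_of_le hst]))
  have := le_max_left (hi m x - hi0 x) 0
  linarith

theorem deriv_le_ae {a b : ℝ} (hab : a ≤ b) (U v : ℝ → ℝ)
    (hU : IntervalIntegrable U volume a b)
    (hvd : ∀ᵐ x, x ∈ uIcc a b → DifferentiableAt ℝ v x)
    (h : ∀ s ∈ Icc a b, ∀ t ∈ Icc a b, s ≤ t → v t - v s ≤ ∫ x in s..t, U x) :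
    ∀ᵐ x, x ∈ Ioo a b → deriv v x ≤ U x := by
  filter_upwards [hvd, hU.ae_hasDerivAt_integral] with x h1 h2 hx
  have hxI : x ∈ uIcc a b := by rw [uIcc_of_le hab]; exact Ioo_subset_Icc_self hx
  have d1 := (h1 hxI).hasDerivAt
  have d2 := h2 hxI a (by simp)
  have d3 := d2.sub d1
  have hmono : MonotoneOn ((fun t => ∫ y in a..t, U y) - v) (Icc a b) := by
    intro s hs t ht hst
    have hsub : ∀ {p q : ℝ}, p ∈ Icc a b → q ∈ Icc a b → IntervalIntegrable U volume p q :=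
      fun hp hq => hU.mono_set (by
        rw [uIcc_of_le hab]; exact (convex_Icc a b).ordConnected.uIcc_subset hp hq)
    have := intervalIntegral.integral_add_adjacent_intervals
      (hsub ⟨le_rfl, hab⟩ hs) (hsub hs ht)
    have := h s hs t ht hst
    simp only [Pi.sub_apply]
    linarith
  have hn : Icc a b ∈ 𝓝 x := Icc_mem_nhds hx.1 hx.2
  have : 0 ≤ derivWithin ((fun t => ∫ y in a..t, U y) - v) (Icc a b) x := hmono.derivWithin_nonneg
  rw [derivWithin_of_mem_nhds hn, d3.deriv] at this
  linarith

theorem core {a b : ℝ} (hab : a ≤ b) (S lo hi : ℕ → ℝ → ℝ) (lo0 hi0 v : ℝ → ℝ) (K : ℝ)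
    (hS : ∀ m, IntegrableOn (S m) (Icc a b))
    (hSb : ∀ m, ∀ t ∈ Icc a b, -lo m t ≤ S m t ∧ S m t ≤ hi m t)
    (mlo : ∀ m, Measurable (lo m)) (mlo0 : Measurable lo0)
    (mhi : ∀ m, Measurable (hi m)) (mhi0 : Measurable hi0)
    (blo : ∀ m, ∀ t ∈ Icc a b, |lo m t| ≤ K) (blo0 : ∀ t ∈ Icc a b, |lo0 t| ≤ K)
    (bhi : ∀ m, ∀ t ∈ Icc a b, |hi m t| ≤ K) (bhi0 : ∀ t ∈ Icc a b, |hi0 t| ≤ K)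
    (hlimlo : ∀ t ∈ Icc a b, Tendsto (fun m => max (lo m t - lo0 t) 0) atTop (𝓝 0))
    (hlim : ∀ t ∈ Icc a b, Tendsto (fun m => max (hi m t - hi0 t) 0) atTop (𝓝 0))
    (hlh : ∀ t ∈ Icc a b, -lo0 t ≤ hi0 t)
    (hv : ∀ t ∈ Icc a b, Tendsto (fun m => ∫ s in a..t, S m s) atTop (𝓝 (v t))) :
    ∃ S0 : ℝ → ℝ, IntegrableOn S0 (Icc a b) ∧
      (∀ t ∈ Icc a b, -lo0 t ≤ S0 t ∧ S0 t ≤ hi0 t) ∧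
      ∀ t ∈ Icc a b, v t = ∫ s in a..t, S0 s := by
  have haI : a ∈ Icc a b := ⟨le_rfl, hab⟩
  have U1 := fun s hs t ht hst => core_up S hi hi0 v K hS (fun m t ht => (hSb m t ht).2) mhi mhi0
    bhi bhi0 hlim hv (s := s) (t := t) hs ht hst
  have U2 := fun s hs t ht hst => core_up (fun m x => - S m x) lo lo0 (fun x => - v x) K
    (fun m => (hS m).neg) (fun m t ht => by linarith [(hSb m t ht).1]) mlo mlo0
    blo blo0 hlimlo (fun t ht => by simpa using (hv t ht).neg) (s := s) (t := t) hs ht hst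
  have va : v a = 0 := by
    refine tendsto_nhds_unique (hv a haI) ?_
    simp
  have iB : ∀ (g : ℝ → ℝ) (C : ℝ), Measurable g → (∀ t ∈ Icc a b, |g t| ≤ C) →
      IntegrableOn g (Icc a b) := by
    intro g C mg bg
    refine Measure.integrableOn_of_bounded (M := C) (by simp) mg.aestronglyMeasurable ?_
    filter_upwards [ae_restrict_mem measurableSet_Icc] with x hx using bg x hx
  have iI : ∀ (g : ℝ → ℝ), IntegrableOn g (Icc a b) → IntervalIntegrable g volume a b := by
    intro g hg
    refine (hg.mono_set ?_).intervalIntegrable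
    rw [uIcc_of_le hab]
  have hK : 0 ≤ K := (abs_nonneg _).trans (bhi0 a haI)
  have bint : ∀ (g : ℝ → ℝ), (∀ t ∈ Icc a b, |g t| ≤ K) → ∀ s ∈ Icc a b, ∀ t ∈ Icc a b, s ≤ t →
      ∫ x in s..t, g x ≤ K * (t - s) := by
    intro g hg s hs t ht hst
    refine (le_abs_self _).trans ?_
    have := intervalIntegral.norm_integral_le_of_norm_le_const (a := s) (b := t) (f := g) (C := K) ?_
    · rwa [abs_of_nonneg (sub_nonneg.2 hst)] at this
    · intro x hx
      exact hg x ((convex_Icc a b).ordConnected.uIcc_subset hs ht (uIoc_subset_uIcc hx))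
  have hLip1 : ∀ s ∈ Icc a b, ∀ t ∈ Icc a b, s ≤ t → |v t - v s| ≤ K * (t - s) := by
    intro s hs t ht hst
    have e1 := U1 s hs t ht hst
    have e2 := U2 s hs t ht hst
    have e3 := bint hi0 bhi0 s hs t ht hst
    have e4 := bint lo0 blo0 s hs t ht hst
    rw [abs_le]; constructor <;> linarith
  have hLip : LipschitzOnWith K.toNNReal v (uIcc a b) := by
    rw [uIcc_of_le hab]
    refine LipschitzOnWith.of_dist_le_mul fun x hx y hy => ?_
    rw [Real.coe_toNNReal _ hK, Real.dist_eq, Real.dist_eq]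
    rcases le_total x y with h | h
    · rw [abs_sub_comm, abs_sub_comm x, abs_of_nonneg (sub_nonneg.2 h)]; exact hLip1 x hx y hy h
    · rw [abs_of_nonneg (sub_nonneg.2 h)]; exact hLip1 y hy x hx h
  have hAC := hLip.absolutelyContinuousOnInterval
  have hd := hAC.ae_differentiableAt
  have D1 := deriv_le_ae hab hi0 v (iI _ (iB _ _ mhi0 bhi0)) hd U1
  have D2 := deriv_le_ae hab lo0 (fun x => - v x) (iI _ (iB _ _ mlo0 blo0))
    (by filter_upwards [hd] with x hx hx' using (hx hx').neg) U2
  have hii := hAC.intervalIntegrable_deriv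
  have hiI : IntegrableOn (deriv v) (Icc a b) := by
    rw [intervalIntegrable_iff_integrableOn_Icc_of_le hab] at hii; exact hii
  let S0 : ℝ → ℝ := fun t => max (-lo0 t) (min (hi0 t) (deriv v t))
  have hae : ∀ᵐ x, x ∈ Ioo a b → S0 x = deriv v x := by
    filter_upwards [D1, D2] with x h1 h2 hx
    have h3 := h1 hx
    have h4 := h2 hx
    rw [deriv.fun_neg] at h4
    simp only [S0]
    rw [min_eq_right h3, max_eq_right (by linarith)]
  have hae' : ∀ᵐ x, x ∈ Icc a b → S0 x = deriv v x := by
    have ea : ∀ᵐ x : ℝ, x ≠ a := by simp [ae_iff, measure_singleton]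
    have eb : ∀ᵐ x : ℝ, x ≠ b := by simp [ae_iff, measure_singleton]
    filter_upwards [hae, ea, eb] with x h1 h2 h3 hx
    exact h1 ⟨lt_of_le_of_ne hx.1 (Ne.symm h2), lt_of_le_of_ne hx.2 h3⟩
  refine ⟨S0, ?_, ?_, ?_⟩
  · refine hiI.congr ?_
    rw [EventuallyEq, ae_restrict_iff' measurableSet_Icc]
    filter_upwards [hae'] with x hx hx' using (hx hx').symm
  · intro t ht
    exact ⟨le_max_left _ _, max_le (hlh t ht) (min_le_left _ _)⟩
  · intro t ht
    have hACt : AbsolutelyContinuousOnInterval v a t := by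
      refine (hLip.mono ?_).absolutelyContinuousOnInterval
      rw [uIcc_of_le hab]
      exact (convex_Icc a b).ordConnected.uIcc_subset haI ht
    have e := hACt.integral_deriv_eq_sub
    rw [va, sub_zero] at e
    rw [← e]
    refine intervalIntegral.integral_congr_ae ?_
    filter_upwards [hae'] with x hx hx'
    exact (hx ((convex_Icc a b).ordConnected.uIcc_subset haI ht (uIoc_subset_uIcc hx'))).symm

/-- Upper end of `chiSet`. -/
def hiF (ε s : ℝ) : ℝ := if s < -bfun ε then ε else 1

/-- Lower end of `chiSet`. -/
def loF (ε s : ℝ) : ℝ := if s ≤ bfun ε then 0 else 1 - ε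

/-- Integral of the upper end along the history. -/
def HI (ε : ℝ) (μ : Measure ℝ) (x : ℝ → ℝ) (t : ℝ) : ℝ := ∫ τ in Iic (0 : ℝ), hiF ε (x (t + τ)) ∂μ

/-- Integral of the lower end along the history. -/
def LO (ε : ℝ) (μ : Measure ℝ) (x : ℝ → ℝ) (t : ℝ) : ℝ := ∫ τ in Iic (0 : ℝ), loF ε (x (t + τ)) ∂μ

/-- Upper end of the interval `w • [L, H]`. -/
def upV (w L H : ℝ) : ℝ := max w 0 * H - max (-w) 0 * L

/-- Upper end of the interval `w t • [LO, HI]`. -/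
def upT (ε : ℝ) (μ : Measure ℝ) (x w : ℝ → ℝ) (t : ℝ) : ℝ := upV (w t) (LO ε μ x t) (HI ε μ x t)

theorem bfun_eq {e : ℝ} (he : e ∈ Icc (0 : ℝ) (1 / 5)) :
    bfun e = e * Real.log (1 - e) + Real.negMulLog e := by
  unfold bfun Real.negMulLog
  split_ifs with h
  · simp [h]
  · rw [Real.log_div (by linarith [he.2]) h]; ring

theorem bfun_nonneg {e : ℝ} (he : e ∈ Icc (0 : ℝ) (1 / 5)) : 0 ≤ bfun e := by
  unfold bfun
  split_ifs with h
  · exact le_rfl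
  · have : 0 < e := lt_of_le_of_ne he.1 (Ne.symm h)
    refine mul_nonneg this.le (Real.log_nonneg ?_)
    rw [le_div_iff₀ this]
    linarith [he.2]

theorem bfun_tendsto {e : ℕ → ℝ} {e0 : ℝ} (he : ∀ m, e m ∈ Icc (0 : ℝ) (1 / 5))
    (he0 : e0 ∈ Icc (0 : ℝ) (1 / 5)) (h : Tendsto e atTop (𝓝 e0)) :
    Tendsto (fun m => bfun (e m)) atTop (𝓝 (bfun e0)) := by
  rw [bfun_eq he0]
  have : (fun m => bfun (e m)) = fun m => e m * Real.log (1 - e m) + Real.negMulLog (e m) :=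
    funext fun m => bfun_eq (he m)
  rw [this]
  refine (h.mul ((tendsto_const_nhds.sub h).log ?_)).add
    ((Real.continuous_negMulLog.tendsto e0).comp h)
  linarith [he0.2]

theorem chiSet_eq {e : ℝ} (he : e ∈ Icc (0 : ℝ) (1 / 5)) (s : ℝ) :
    chiSet e s = Icc (loF e s) (hiF e s) := by
  have := bfun_nonneg he
  unfold chiSet loF hiF
  split_ifs with h1 h2 h3 <;> first | rfl | (exfalso; linarith)

theorem hiF_bd {e : ℝ} (he : e ∈ Icc (0 : ℝ) (1 / 5)) (s : ℝ) : 0 ≤ hiF e s ∧ hiF e s ≤ 1 := by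
  obtain ⟨h1, h2⟩ := he
  unfold hiF
  split_ifs <;> constructor <;> linarith

theorem loF_bd {e : ℝ} (he : e ∈ Icc (0 : ℝ) (1 / 5)) (s : ℝ) : 0 ≤ loF e s ∧ loF e s ≤ 1 := by
  obtain ⟨h1, h2⟩ := he
  unfold loF
  split_ifs <;> constructor <;> linarith

theorem lo_le_hi {e : ℝ} (he : e ∈ Icc (0 : ℝ) (1 / 5)) (s : ℝ) : loF e s ≤ hiF e s := by
  have := bfun_nonneg he
  obtain ⟨h1, h2⟩ := he
  unfold hiF loF
  split_ifs <;> linarith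

theorem hiF_meas (e : ℝ) : Measurable (hiF e) :=
  Measurable.ite measurableSet_Iio measurable_const measurable_const

theorem loF_meas (e : ℝ) : Measurable (loF e) :=
  Measurable.ite measurableSet_Iic measurable_const measurable_const

theorem hiF_lim {e s : ℕ → ℝ} {e0 s0 : ℝ} (he : ∀ m, e m ∈ Icc (0 : ℝ) (1 / 5))
    (he0 : e0 ∈ Icc (0 : ℝ) (1 / 5)) (h : Tendsto e atTop (𝓝 e0)) (hs : Tendsto s atTop (𝓝 s0)) :
    Tendsto (fun m => max (hiF (e m) (s m) - hiF e0 s0) 0) atTop (𝓝 0) := by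
  have hb := bfun_tendsto he he0 h
  by_cases hc : s0 < -bfun e0
  · have ev : ∀ᶠ m in atTop, s m < -bfun (e m) := hs.eventually_lt hb.neg hc
    have : Tendsto (fun m => max (e m - e0) 0) atTop (𝓝 (max (e0 - e0) 0)) :=
      (h.sub tendsto_const_nhds).max tendsto_const_nhds
    rw [sub_self, max_self] at this
    refine this.congr' ?_
    filter_upwards [ev] with m hm
    simp [hiF, hc, hm]
  · refine tendsto_const_nhds.congr fun m => ?_
    have := (hiF_bd (he m) (s m)).2
    have h2 : hiF e0 s0 = 1 := by simp [hiF, hc]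
    rw [max_eq_right]; linarith

theorem loF_lim {e s : ℕ → ℝ} {e0 s0 : ℝ} (he : ∀ m, e m ∈ Icc (0 : ℝ) (1 / 5))
    (he0 : e0 ∈ Icc (0 : ℝ) (1 / 5)) (h : Tendsto e atTop (𝓝 e0)) (hs : Tendsto s atTop (𝓝 s0)) :
    Tendsto (fun m => max (loF e0 s0 - loF (e m) (s m)) 0) atTop (𝓝 0) := by
  have hb := bfun_tendsto he he0 h
  by_cases hc : s0 ≤ bfun e0
  · refine tendsto_const_nhds.congr fun m => ?_
    have := (loF_bd (he m) (s m)).1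
    have h2 : loF e0 s0 = 0 := by simp [loF, hc]
    rw [max_eq_right]; linarith
  · have ev : ∀ᶠ m in atTop, bfun (e m) < s m := hb.eventually_lt hs (not_le.1 hc)
    have : Tendsto (fun m => max (e m - e0) 0) atTop (𝓝 (max (e0 - e0) 0)) :=
      (h.sub tendsto_const_nhds).max tendsto_const_nhds
    rw [sub_self, max_self] at this
    refine this.congr' ?_
    filter_upwards [ev] with m hm
    simp [loF, hc, not_le.2 hm]

theorem int_bd {ν : Measure ℝ} [IsFiniteMeasure ν] {f : ℝ → ℝ} (hf : Measurable f) {C : ℝ}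
    (hb : ∀ t, 0 ≤ f t ∧ f t ≤ C) : Integrable f ν := by
  refine Integrable.of_bound hf.aestronglyMeasurable C (Eventually.of_forall fun t => ?_)
  rw [Real.norm_eq_abs, abs_of_nonneg (hb t).1]
  exact (hb t).2

/-- One-sided limit of integrals. -/
theorem int_lim {ν : Measure ℝ} [IsFiniteMeasure ν] {f g : ℕ → ℝ → ℝ}
    (hf : ∀ m, Measurable (f m)) (hfb : ∀ m t, 0 ≤ f m t ∧ f m t ≤ 1)
    (hg : ∀ m, Measurable (g m)) (hgb : ∀ m t, 0 ≤ g m t ∧ g m t ≤ 1)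
    (h : ∀ᵐ t ∂ν, Tendsto (fun m => max (f m t - g m t) 0) atTop (𝓝 0)) :
    Tendsto (fun m => max ((∫ t, f m t ∂ν) - ∫ t, g m t ∂ν) 0) atTop (𝓝 0) := by
  have mm : ∀ m, Measurable fun t => max (f m t - g m t) 0 := fun m =>
    ((hf m).sub (hg m)).max measurable_const
  have mb : ∀ m t, 0 ≤ max (f m t - g m t) 0 ∧ max (f m t - g m t) 0 ≤ 1 := fun m t =>
    ⟨le_max_right _ _, max_le (by linarith [(hfb m t).2, (hgb m t).1]) zero_le_one⟩
  have h1 : Tendsto (fun m => ∫ t, max (f m t - g m t) 0 ∂ν) atTop (𝓝 (∫ _, (0 : ℝ) ∂ν)) := by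
    refine tendsto_integral_of_dominated_convergence (fun _ => (1 : ℝ))
      (fun m => (mm m).aestronglyMeasurable) (integrable_const _) ?_ h
    refine fun m => Eventually.of_forall fun t => ?_
    rw [Real.norm_eq_abs, abs_of_nonneg (mb m t).1]
    exact (mb m t).2
  rw [integral_zero] at h1
  refine squeeze_zero (fun m => le_max_right _ _) (fun m => ?_) h1
  refine max_le ?_ (integral_nonneg fun t => (mb m t).1)
  rw [← integral_sub (int_bd (hf m) (hfb m)) (int_bd (hg m) (hgb m))]
  exact integral_mono ((int_bd (hf m) (hfb m)).sub (int_bd (hg m) (hgb m)))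
    (int_bd (mm m) (mb m)) fun t => le_max_left _ _

section
variable {μ : Measure ℝ} [IsFiniteMeasure (μ.restrict (Iic (0 : ℝ)))]

theorem HI_lim {e : ℕ → ℝ} {e0 : ℝ} (he : ∀ m, e m ∈ Icc (0 : ℝ) (1 / 5))
    (he0 : e0 ∈ Icc (0 : ℝ) (1 / 5)) (h : Tendsto e atTop (𝓝 e0))
    {x : ℕ → ℝ → ℝ} {x0 : ℝ → ℝ} (hx : ∀ m, Measurable (x m)) (hx0 : Measurable x0) (t : ℝ)
    (hl : ∀ s ≤ t, Tendsto (fun m => x m s) atTop (𝓝 (x0 s))) :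
    Tendsto (fun m => max (HI (e m) μ (x m) t - HI e0 μ x0 t) 0) atTop (𝓝 0) := by
  refine int_lim (f := fun m τ => hiF (e m) (x m (t + τ))) (g := fun m τ => hiF e0 (x0 (t + τ)))
    (fun m => (hiF_meas _).comp ((hx m).comp (measurable_const_add t)))
    (fun m τ => hiF_bd (he m) _)
    (fun m => (hiF_meas _).comp (hx0.comp (measurable_const_add t)))
    (fun m τ => hiF_bd he0 _) ?_
  filter_upwards [ae_restrict_mem measurableSet_Iic] with τ hτ
  exact hiF_lim he he0 h (hl _ (by linarith [mem_Iic.1 hτ]))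

theorem LO_lim {e : ℕ → ℝ} {e0 : ℝ} (he : ∀ m, e m ∈ Icc (0 : ℝ) (1 / 5))
    (he0 : e0 ∈ Icc (0 : ℝ) (1 / 5)) (h : Tendsto e atTop (𝓝 e0))
    {x : ℕ → ℝ → ℝ} {x0 : ℝ → ℝ} (hx : ∀ m, Measurable (x m)) (hx0 : Measurable x0) (t : ℝ)
    (hl : ∀ s ≤ t, Tendsto (fun m => x m s) atTop (𝓝 (x0 s))) :
    Tendsto (fun m => max (LO e0 μ x0 t - LO (e m) μ (x m) t) 0) atTop (𝓝 0) := by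
  refine int_lim (g := fun m τ => loF (e m) (x m (t + τ))) (f := fun m τ => loF e0 (x0 (t + τ)))
    (fun m => (loF_meas _).comp (hx0.comp (measurable_const_add t)))
    (fun m τ => loF_bd he0 _)
    (fun m => (loF_meas _).comp ((hx m).comp (measurable_const_add t)))
    (fun m τ => loF_bd (he m) _) ?_
  filter_upwards [ae_restrict_mem measurableSet_Iic] with τ hτ
  exact loF_lim he he0 h (hl _ (by linarith [mem_Iic.1 hτ]))

theorem HI_int {e : ℝ} (he : e ∈ Icc (0 : ℝ) (1 / 5)) {x : ℝ → ℝ} (hx : Measurable x) (t : ℝ) :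
    Integrable (fun τ => hiF e (x (t + τ))) (μ.restrict (Iic (0 : ℝ))) :=
  int_bd ((hiF_meas _).comp (hx.comp (measurable_const_add t))) (fun _ => hiF_bd he _)

theorem LO_int {e : ℝ} (he : e ∈ Icc (0 : ℝ) (1 / 5)) {x : ℝ → ℝ} (hx : Measurable x) (t : ℝ) :
    Integrable (fun τ => loF e (x (t + τ))) (μ.restrict (Iic (0 : ℝ))) :=
  int_bd ((loF_meas _).comp (hx.comp (measurable_const_add t))) (fun _ => loF_bd he _)

theorem HILO {e : ℝ} (he : e ∈ Icc (0 : ℝ) (1 / 5)) {x : ℝ → ℝ} (hx : Measurable x) (t : ℝ) :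
    0 ≤ LO e μ x t ∧ LO e μ x t ≤ HI e μ x t ∧ HI e μ x t ≤ (μ.restrict (Iic 0)).real univ := by
  refine ⟨integral_nonneg fun τ => (loF_bd he _).1,
    integral_mono (LO_int he hx t) (HI_int he hx t) fun τ => lo_le_hi he _, ?_⟩
  have := integral_mono (HI_int (μ := μ) he hx t) (integrable_const (1 : ℝ))
    fun τ => (hiF_bd he (x (t + τ))).2
  refine this.trans ?_
  simp

theorem HI_meas (e : ℝ) {x : ℝ → ℝ} (hx : Measurable x) : Measurable (HI e μ x) := by
  have : Measurable (fun p : ℝ × ℝ => hiF e (x (p.1 + p.2))) :=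
    (hiF_meas _).comp (hx.comp (measurable_fst.add measurable_snd))
  exact (this.stronglyMeasurable.integral_prod_right' (ν := μ.restrict (Iic 0))).measurable

theorem LO_meas (e : ℝ) {x : ℝ → ℝ} (hx : Measurable x) : Measurable (LO e μ x) := by
  have : Measurable (fun p : ℝ × ℝ => loF e (x (p.1 + p.2))) :=
    (loF_meas _).comp (hx.comp (measurable_fst.add measurable_snd))
  exact (this.stronglyMeasurable.integral_prod_right' (ν := μ.restrict (Iic 0))).measurable

theorem upT_meas (e : ℝ) {x w : ℝ → ℝ} (hx : Measurable x) (hw : Measurable w) :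
    Measurable (upT e μ x w) := by
  unfold upT upV
  exact ((hw.max measurable_const).mul (HI_meas e hx)).sub
    ((hw.neg.max measurable_const).mul (LO_meas e hx))

theorem upT_bd {e : ℝ} (he : e ∈ Icc (0 : ℝ) (1 / 5)) {x w : ℝ → ℝ} (hx : Measurable x) (t : ℝ) :
    |upT e μ x w t| ≤ |w t| * (μ.restrict (Iic 0)).real univ := by
  obtain ⟨h1, h2, h3⟩ := HILO (μ := μ) he hx t
  unfold upT upV
  rcases le_total 0 (w t) with h | h
  · rw [max_eq_left h, max_eq_right (by linarith : -w t ≤ 0), zero_mul, sub_zero, abs_mul,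
      abs_of_nonneg (h1.trans h2)]
    exact mul_le_mul_of_nonneg_left h3 (abs_nonneg _)
  · rw [max_eq_right h, max_eq_left (by linarith : 0 ≤ -w t), zero_mul, zero_sub, abs_neg, abs_mul,
      abs_neg, abs_of_nonneg h1]
    exact mul_le_mul_of_nonneg_left (h2.trans h3) (abs_nonneg _)

theorem upT_lim {e : ℕ → ℝ} {e0 : ℝ} (he : ∀ m, e m ∈ Icc (0 : ℝ) (1 / 5))
    (he0 : e0 ∈ Icc (0 : ℝ) (1 / 5)) (h : Tendsto e atTop (𝓝 e0))
    {x : ℕ → ℝ → ℝ} {x0 : ℝ → ℝ} (hx : ∀ m, Measurable (x m)) (hx0 : Measurable x0) (t : ℝ)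
    (hl : ∀ s ≤ t, Tendsto (fun m => x m s) atTop (𝓝 (x0 s)))
    {w : ℕ → ℝ → ℝ} {w0 : ℝ → ℝ} (hw : Tendsto (fun m => w m t) atTop (𝓝 (w0 t))) :
    Tendsto (fun m => max (upT (e m) μ (x m) (w m) t - upT e0 μ x0 w0 t) 0) atTop (𝓝 0) := by
  have H1 := HI_lim (μ := μ) he he0 h hx hx0 t hl
  have H2 := LO_lim (μ := μ) he he0 h hx hx0 t hl
  have p1 : Tendsto (fun m => max (w m t) 0) atTop (𝓝 (max (w0 t) 0)) :=
    hw.max tendsto_const_nhds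
  have p2 : Tendsto (fun m => max (-w m t) 0) atTop (𝓝 (max (-w0 t) 0)) :=
    hw.neg.max tendsto_const_nhds
  have R := (((((p1.sub_const (max (w0 t) 0)).mul_const (HI e0 μ x0 t)).add (p1.mul H1)).sub
    ((p2.sub_const (max (-w0 t) 0)).mul_const (LO e0 μ x0 t))).add (p2.mul H2)).max
    (tendsto_const_nhds (x := (0:ℝ)))
  simp only [sub_self, zero_mul, mul_zero, add_zero, max_self] at R
  refine squeeze_zero (fun m => le_max_right _ _) (fun m => ?_) R
  refine max_le_max ?_ le_rfl
  unfold upT upV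
  have a1 := mul_le_mul_of_nonneg_left (le_max_left (HI (e m) μ (x m) t - HI e0 μ x0 t) 0)
    (le_max_right (w m t) 0)
  have a2 := mul_le_mul_of_nonneg_left (le_max_left (LO e0 μ x0 t - LO (e m) μ (x m) t) 0)
    (le_max_right (-w m t) 0)
  nlinarith [a1, a2]

theorem upV_neg_le {w L H : ℝ} (h : L ≤ H) : -upV (-w) L H ≤ upV w L H := by
  unfold upV
  have h1 := mul_nonneg (le_max_right w 0) (sub_nonneg.2 h)
  have h2 := mul_nonneg (le_max_right (-w) 0) (sub_nonneg.2 h)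
  rw [neg_neg]
  nlinarith

theorem mem_smul_Icc {w L H y : ℝ} (h : L ≤ H) :
    y ∈ w • Icc L H ↔ -upV (-w) L H ≤ y ∧ y ≤ upV w L H := by
  have : w • Icc L H = uIcc (w * L) (w * H) := by
    rw [← uIcc_of_le h, ← image_const_mul_uIcc]; rfl
  rw [this]
  unfold upV
  rw [neg_neg]
  rcases le_total 0 w with hw | hw
  · rw [max_eq_left hw, max_eq_right (by linarith : -w ≤ 0),
      uIcc_of_le (mul_le_mul_of_nonneg_left h hw), mem_Icc]
    simp
  · rw [max_eq_right hw, max_eq_left (by linarith : 0 ≤ -w),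
      uIcc_of_ge (mul_le_mul_of_nonpos_left h hw), mem_Icc]
    simp

theorem aumann_eq {e : ℝ} (he : e ∈ Icc (0 : ℝ) (1 / 5)) {x : ℝ → ℝ} (hx : Measurable x) (t : ℝ) :
    aumann (fun τ => chiSet e (x (t + τ))) μ = Icc (LO e μ x t) (HI e μ x t) := by
  have iL := LO_int (μ := μ) he hx t
  have iH := HI_int (μ := μ) he hx t
  ext y
  constructor
  · rintro ⟨s, ms, is, hs, rfl⟩
    simp only [chiSet_eq he] at hs
    constructor
    · exact setIntegral_mono_on iL is measurableSet_Iic fun τ hτ => (hs τ hτ).1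
    · exact setIntegral_mono_on is iH measurableSet_Iic fun τ hτ => (hs τ hτ).2
  · intro hy
    have hLH := (HILO (μ := μ) he hx t).2.1
    rw [← segment_eq_Icc hLH] at hy
    obtain ⟨a, b, ha, hb, hab, rfl⟩ := hy
    refine ⟨fun τ => a * loF e (x (t + τ)) + b * hiF e (x (t + τ)), ?_, ?_, ?_, ?_⟩
    · exact (((loF_meas _).comp (hx.comp (measurable_const_add t))).const_mul a).add
        (((hiF_meas _).comp (hx.comp (measurable_const_add t))).const_mul b)
    · exact (iL.const_mul a).add (iH.const_mul b)
    · intro τ _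
      simp only [chiSet_eq he]
      rw [← segment_eq_Icc (lo_le_hi he _)]
      exact ⟨a, b, ha, hb, hab, rfl⟩
    · rw [integral_add (iL.const_mul a) (iH.const_mul b), integral_const_mul, integral_const_mul]
      rfl

end

section
variable {n : ℕ}

/-- Upper end of the `i`-th factor of `X^ε` (`σ = 1`), minus the lower end (`σ = -1`). -/
def upX (σ ε : ℝ) (μ : IdxZ n → Measure ℝ) (c : IdxZ n → ℝ) (Γ : Fin n → ℝ) (u : ℝ → NState n)
    (i : Fin n) (t : ℝ) : ℝ :=
  ∑ k : Fin n, if h : k ≠ i then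
    upT ε (μ ⟨(k, i), h⟩) (fun s => (u s).1 k - Γ k)
      (fun s => σ * ((u s).2 ⟨(k, i), h⟩ - c ⟨(k, i), h⟩)) t else 0

/-- Upper end of the `p`-th factor of `X^ε` (`σ = 1`), minus the lower end (`σ = -1`). -/
def upZ (σ ε : ℝ) (μ : IdxZ n → Measure ℝ) (d : IdxZ n → ℝ) (Γ : Fin n → ℝ) (u : ℝ → NState n)
    (p : IdxZ n) (t : ℝ) : ℝ :=
  upT ε (μ p) (fun s => (u s).1 p.1.1 - Γ p.1.1) (fun s => σ * (d p * max ((u s).1 p.1.2) 0)) t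

theorem cont_x {u : ℝ → NState n} (hu : Continuous u) (i : Fin n) :
    Continuous (fun s => (u s).1 i) := (continuous_apply i).comp (continuous_fst.comp hu)

theorem cont_z {u : ℝ → NState n} (hu : Continuous u) (p : IdxZ n) :
    Continuous (fun s => (u s).2 p) := (continuous_apply p).comp (continuous_snd.comp hu)

theorem abs_x (v : NState n) (i : Fin n) : |v.1 i| ≤ ‖v‖ :=
  (norm_le_pi_norm v.1 i).trans (norm_fst_le v)

theorem abs_z (v : NState n) (p : IdxZ n) : |v.2 p| ≤ ‖v‖ :=
  (norm_le_pi_norm v.2 p).trans (norm_snd_le v)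

variable {μ : IdxZ n → Measure ℝ} [hfin : ∀ p, IsFiniteMeasure ((μ p).restrict (Iic (0 : ℝ)))]

theorem upX_meas (σ e : ℝ) (c : IdxZ n → ℝ) (Γ : Fin n → ℝ) {u : ℝ → NState n} (hu : Continuous u)
    (i : Fin n) : Measurable (upX σ e μ c Γ u i) := by
  unfold upX
  refine Finset.measurable_fun_sum _ fun k _ => ?_
  by_cases h : k ≠ i
  · simp only [dif_pos h]
    exact upT_meas e ((cont_x hu k).sub continuous_const).measurable
      (continuous_const.mul ((cont_z hu _).sub continuous_const)).measurable
  · simp only [dif_neg h]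
    exact measurable_const

theorem upZ_meas (σ e : ℝ) (d : IdxZ n → ℝ) (Γ : Fin n → ℝ) {u : ℝ → NState n} (hu : Continuous u)
    (p : IdxZ n) : Measurable (upZ σ e μ d Γ u p) := by
  unfold upZ
  exact upT_meas e ((cont_x hu _).sub continuous_const).measurable
    (continuous_const.mul (continuous_const.mul ((cont_x hu _).max continuous_const))).measurable

theorem up_lim (σ : ℝ) {e : ℕ → ℝ} {e0 : ℝ} (he : ∀ m, e m ∈ Icc (0 : ℝ) (1 / 5))
    (he0 : e0 ∈ Icc (0 : ℝ) (1 / 5)) (h : Tendsto e atTop (𝓝 e0)) (c d : IdxZ n → ℝ)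
    (Γ : Fin n → ℝ)
    {u : ℕ → ℝ → NState n} {u0 : ℝ → NState n} (hu : ∀ m, Continuous (u m)) (hu0 : Continuous u0)
    (t : ℝ) (hl : ∀ s ≤ t, Tendsto (fun m => u m s) atTop (𝓝 (u0 s))) :
    (∀ i, Tendsto (fun m => max (upX σ (e m) μ c Γ (u m) i t - upX σ e0 μ c Γ u0 i t) 0)
      atTop (𝓝 0)) ∧
    ∀ p, Tendsto (fun m => max (upZ σ (e m) μ d Γ (u m) p t - upZ σ e0 μ d Γ u0 p t) 0)
      atTop (𝓝 0) := by
  have lx : ∀ s ≤ t, ∀ k, Tendsto (fun m => (u m s).1 k) atTop (𝓝 ((u0 s).1 k)) := fun s hs k =>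
    (((continuous_apply k).comp continuous_fst).tendsto (u0 s)).comp (hl s hs)
  have lz : ∀ s ≤ t, ∀ k, Tendsto (fun m => (u m s).2 k) atTop (𝓝 ((u0 s).2 k)) := fun s hs k =>
    (((continuous_apply k).comp continuous_snd).tendsto (u0 s)).comp (hl s hs)
  have mx : ∀ (v : ℝ → NState n), Continuous v → ∀ k, Measurable (fun s => (v s).1 k - Γ k) :=
    fun v hv k => ((cont_x hv k).sub continuous_const).measurable
  constructor
  · intro i
    let F : ℕ → Fin n → ℝ := fun m k => if h : k ≠ i then
      max (upT (e m) (μ ⟨(k, i), h⟩) (fun s => (u m s).1 k - Γ k)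
        (fun s => σ * ((u m s).2 ⟨(k, i), h⟩ - c ⟨(k, i), h⟩)) t -
        upT e0 (μ ⟨(k, i), h⟩) (fun s => (u0 s).1 k - Γ k)
        (fun s => σ * ((u0 s).2 ⟨(k, i), h⟩ - c ⟨(k, i), h⟩)) t) 0 else 0
    have hF0 : ∀ m k, 0 ≤ F m k := by
      intro m k
      simp only [F]
      split_ifs
      · exact le_max_right _ _
      · exact le_rfl
    have hF : ∀ k, Tendsto (fun m => F m k) atTop (𝓝 0) := by
      intro k
      by_cases hk : k ≠ i
      · simp only [F, dif_pos hk]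
        exact upT_lim he he0 h (fun m => mx _ (hu m) k) (mx _ hu0 k) t
          (fun s hs => (lx s hs k).sub_const _)
          (((lz t le_rfl _).sub_const _).const_mul σ)
      · simp only [F, dif_neg hk]
        exact tendsto_const_nhds
    have hS : Tendsto (fun m => ∑ k, F m k) atTop (𝓝 0) := by
      have := tendsto_finsetSum (Finset.univ : Finset (Fin n)) fun k _ => hF k
      simpa using this
    refine squeeze_zero (fun m => le_max_right _ _) (fun m => ?_) hS
    refine max_le ?_ (Finset.sum_nonneg fun k _ => hF0 m k)
    unfold upX
    rw [← Finset.sum_sub_distrib]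
    refine Finset.sum_le_sum fun k _ => ?_
    simp only [F]
    split_ifs
    · exact le_max_left _ _
    · simp
  · intro p
    exact upT_lim he he0 h (fun m => mx _ (hu m) _) (mx _ hu0 _) t
          (fun s hs => (lx s hs _).sub_const _)
          ((((lx t le_rfl _).max tendsto_const_nhds).const_mul _).const_mul σ)

theorem up_bd (c d : IdxZ n → ℝ) (Γ : Fin n → ℝ) : ∃ K : ℝ, 0 ≤ K ∧
    ∀ σ : ℝ, |σ| = 1 → ∀ e ∈ Icc (0 : ℝ) (1 / 5), ∀ u : ℝ → NState n, Continuous u → ∀ t,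
      (∀ i, |upX σ e μ c Γ u i t| ≤ K * (‖u t‖ + 1)) ∧
      (∀ p, |upZ σ e μ d Γ u p t| ≤ K * (‖u t‖ + 1)) := by
  let M : ℝ := ∑ p : IdxZ n, ((μ p).restrict (Iic 0)).real univ
  have hM : ∀ p, ((μ p).restrict (Iic 0)).real univ ≤ M := fun p =>
    Finset.single_le_sum (f := fun p : IdxZ n => ((μ p).restrict (Iic (0:ℝ))).real univ)
      (fun _ _ => measureReal_nonneg) (Finset.mem_univ p)
  have hM0 : 0 ≤ M := Finset.sum_nonneg fun _ _ => measureReal_nonneg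
  have hc0 := norm_nonneg c
  have hd0 := norm_nonneg d
  have hn0 : (0:ℝ) ≤ n := Nat.cast_nonneg n
  have q1 : 0 ≤ (n : ℝ) * ((1 + ‖c‖) * M) := by positivity
  have q2 : 0 ≤ ‖d‖ * M := by positivity
  refine ⟨n * ((1 + ‖c‖) * M) + ‖d‖ * M, by linarith, ?_⟩
  intro σ hσ e he u hu t
  have hu1 : 0 ≤ ‖u t‖ := norm_nonneg _
  constructor
  · intro i
    have : |upX σ e μ c Γ u i t| ≤ ∑ k : Fin n, (‖u t‖ + ‖c‖) * M := by
      unfold upX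
      refine (Finset.abs_sum_le_sum_abs _ _).trans (Finset.sum_le_sum fun k _ => ?_)
      split_ifs with h
      · refine (upT_bd he ((cont_x hu k).sub continuous_const).measurable t).trans ?_
        refine mul_le_mul ?_ (hM _) measureReal_nonneg (by positivity)
        rw [abs_mul, hσ, one_mul]
        exact (abs_sub _ _).trans (add_le_add (abs_z _ _) (norm_le_pi_norm c _))
      · simp; positivity
    refine this.trans ?_
    rw [Finset.sum_const, Finset.card_univ, Fintype.card_fin, nsmul_eq_mul]
    have : (‖u t‖ + ‖c‖) * M ≤ (1 + ‖c‖) * M * (‖u t‖ + 1) := by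
      have : ‖u t‖ + ‖c‖ ≤ (1 + ‖c‖) * (‖u t‖ + 1) := by nlinarith
      nlinarith
    have h3 := mul_le_mul_of_nonneg_left this hn0
    have h4 : 0 ≤ ‖d‖ * M * (‖u t‖ + 1) := by positivity
    nlinarith
  · intro p
    unfold upZ
    refine (upT_bd he ((cont_x hu _).sub continuous_const).measurable t).trans ?_
    have h1 : |σ * (d p * max ((u t).1 p.1.2) 0)| ≤ ‖d‖ * (‖u t‖ + 1) := by
      rw [abs_mul, hσ, one_mul, abs_mul]
      refine mul_le_mul (norm_le_pi_norm d p) ?_ (abs_nonneg _) hd0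
      rw [abs_of_nonneg (le_max_right _ _)]
      refine max_le ?_ (by linarith)
      linarith [(le_abs_self _).trans (abs_x (u t) p.1.2)]
    have h2 := mul_le_mul h1 (hM p) measureReal_nonneg (by positivity)
    have h3 : 0 ≤ (n : ℝ) * ((1 + ‖c‖) * M) * (‖u t‖ + 1) := by positivity
    nlinarith

theorem upT_pair {ν : Measure ℝ} [IsFiniteMeasure (ν.restrict (Iic (0 : ℝ)))] {e : ℝ}
    (he : e ∈ Icc (0 : ℝ) (1 / 5)) {x w : ℝ → ℝ} (hx : Measurable x) (t y : ℝ) :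
    y ∈ w t • aumann (fun τ => chiSet e (x (t + τ))) ν ↔
      -upT e ν x (fun s => -1 * w s) t ≤ y ∧ y ≤ upT e ν x (fun s => 1 * w s) t := by
  rw [aumann_eq he hx, mem_smul_Icc (HILO he hx t).2.1]
  simp [upT]

theorem up_low_le {e : ℝ} (he : e ∈ Icc (0 : ℝ) (1 / 5)) (c d : IdxZ n → ℝ) (Γ : Fin n → ℝ)
    {u : ℝ → NState n} (hu : Continuous u) (t : ℝ) :
    (∀ i, -upX (-1) e μ c Γ u i t ≤ upX 1 e μ c Γ u i t) ∧
    (∀ p, -upZ (-1) e μ d Γ u p t ≤ upZ 1 e μ d Γ u p t) := by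
  have key : ∀ p k (w : ℝ → ℝ), -upT e (μ p) (fun s => (u s).1 k - Γ k) (fun s => -1 * w s) t ≤
      upT e (μ p) (fun s => (u s).1 k - Γ k) (fun s => 1 * w s) t := by
    intro p k w
    have := upV_neg_le (w := w t) (HILO (μ := μ p) (x := fun s => (u s).1 k - Γ k) he
      ((cont_x hu k).sub (continuous_const (y := Γ k))).measurable t).2.1
    simpa [upT] using this
  constructor
  · intro i
    unfold upX
    rw [← Finset.sum_neg_distrib]
    refine Finset.sum_le_sum fun k _ => ?_
    split_ifs
    · exact key _ _ _
    · simp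
  · intro p
    exact key _ _ _

theorem Xset_iff {e : ℝ} (he : e ∈ Icc (0 : ℝ) (1 / 5)) (c d : IdxZ n → ℝ) (Γ : Fin n → ℝ)
    {u : ℝ → NState n} (hu : Continuous u) (t : ℝ) (v : NState n) :
    v ∈ Xset e μ c d Γ (hist u t) ↔
      (∀ i, -upX (-1) e μ c Γ u i t ≤ v.1 i ∧ v.1 i ≤ upX 1 e μ c Γ u i t) ∧
      (∀ p, -upZ (-1) e μ d Γ u p t ≤ v.2 p ∧ v.2 p ≤ upZ 1 e μ d Γ u p t) := by
  have mx : ∀ k, Measurable (fun s => (u s).1 k - Γ k) :=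
    fun k => ((cont_x hu k).sub continuous_const).measurable
  unfold Xset
  rw [mem_ofPred_eq]
  refine and_congr (forall_congr' fun i => ?_) (forall_congr' fun p => ?_)
  · have hk : ∀ k (h : k ≠ i) (y : ℝ),
        y ∈ ((hist u t 0).2 ⟨(k, i), h⟩ - c ⟨(k, i), h⟩) •
          aumann (fun τ => chiSet e ((hist u t τ).1 k - Γ k)) (μ ⟨(k, i), h⟩) ↔ _ := fun k h y => by
      have := upT_pair (ν := μ ⟨(k, i), h⟩) he (mx k)
        (w := fun s => (u s).2 ⟨(k, i), h⟩ - c ⟨(k, i), h⟩) t y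
      simp only [hist, add_zero]
      exact this
    unfold XsetX
    rw [mem_ofPred_eq]
    constructor
    · rintro ⟨g, gi, hg, hv⟩
      rw [hv]
      unfold upX
      rw [← Finset.sum_neg_distrib]
      constructor
      · refine Finset.sum_le_sum fun k _ => ?_
        split_ifs with h
        · exact ((hk k h _).1 (hg k h)).1
        · rw [not_not] at h; subst h; simp [gi]
      · refine Finset.sum_le_sum fun k _ => ?_
        split_ifs with h
        · exact ((hk k h _).1 (hg k h)).2
        · rw [not_not] at h; subst h; simp [gi]
    · intro hv
      have hle := (up_low_le (μ := μ) he c d Γ hu t).1 i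
      have hv' : v.1 i ∈ Icc (-upX (-1) e μ c Γ u i t) (upX 1 e μ c Γ u i t) := hv
      rw [← segment_eq_Icc hle] at hv'
      obtain ⟨a, b, ha, hb, hab, hv2⟩ := hv'
      let U : ℝ → Fin n → ℝ := fun σ k => if h : k ≠ i then
        upT e (μ ⟨(k, i), h⟩) (fun s => (u s).1 k - Γ k)
          (fun s => σ * ((u s).2 ⟨(k, i), h⟩ - c ⟨(k, i), h⟩)) t else 0
      refine ⟨fun k => a * (-U (-1) k) + b * U 1 k, by simp [U], ?_, ?_⟩
      · intro k h
        rw [hk k h]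
        simp only [U, dif_pos h]
        have key := upV_neg_le (w := (u t).2 ⟨(k, i), h⟩ - c ⟨(k, i), h⟩)
          (HILO (μ := μ ⟨(k, i), h⟩) he (mx k) t).2.1
        have key2 : -upT e (μ ⟨(k, i), h⟩) (fun s => (u s).1 k - Γ k)
            (fun s => -1 * ((u s).2 ⟨(k, i), h⟩ - c ⟨(k, i), h⟩)) t ≤
            upT e (μ ⟨(k, i), h⟩) (fun s => (u s).1 k - Γ k)
            (fun s => 1 * ((u s).2 ⟨(k, i), h⟩ - c ⟨(k, i), h⟩)) t := by
          simpa [upT] using key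
        rw [← mem_Icc, ← segment_eq_Icc key2]
        exact ⟨a, b, ha, hb, hab, rfl⟩
      · rw [Finset.sum_add_distrib, ← Finset.mul_sum, ← Finset.mul_sum, Finset.sum_neg_distrib]
        exact hv2.symm
  · have := upT_pair (ν := μ p) he (mx p.1.1)
        (w := fun s => d p * max ((u s).1 p.1.2) 0) t (v.2 p)
    simp only [hist, add_zero]
    exact this

theorem Xset_congr (e : ℝ) (c d : IdxZ n → ℝ) (Γ : Fin n → ℝ)
    {u u' : ℝ → NState n} (h : ∀ s ≤ 0, u s = u' s) :
    Xset e μ c d Γ u ⊆ Xset e μ c d Γ u' := by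
  have ha : ∀ k ν, aumann (fun τ => chiSet e ((u τ).1 k - Γ k)) ν ⊆
      aumann (fun τ => chiSet e ((u' τ).1 k - Γ k)) ν := by
    rintro k ν y ⟨s, h1, h2, h3, h4⟩
    refine ⟨s, h1, h2, fun t ht => ?_, h4⟩
    have := h3 t ht
    simp only [h t ht] at this
    exact this
  rintro v ⟨h1, h2⟩
  refine ⟨fun i => ?_, fun p => ?_⟩
  · obtain ⟨g, g1, g2, g3⟩ := h1 i
    refine ⟨g, g1, fun k hk => ?_, g3⟩
    rw [← h 0 le_rfl]
    exact smul_set_mono (ha _ _) (g2 k hk)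
  · rw [← h 0 le_rfl]
    exact smul_set_mono (ha _ _) (h2 p)

end

/-- Scalar integral equation with a bounded control. -/
def ScalEq (A I : ℝ → ℝ) (a b : ℝ) (x S lo hi : ℝ → ℝ) : Prop :=
  IntegrableOn S (Icc a b) ∧ (∀ t ∈ Icc a b, -lo t ≤ S t ∧ S t ≤ hi t) ∧
    ∀ t ∈ Icc a b, x t = x a + ∫ s in a..t, ((-(A (x s)) * x s + I s) + S s)

section
variable {n : ℕ}

/-- Componentwise form of a solution. -/
def CompSol (ε : ℝ) (A : Fin n → ℝ → ℝ) (B : IdxZ n → ℝ → ℝ)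
    (μ : IdxZ n → Measure ℝ) (c d : IdxZ n → ℝ) (Γ : Fin n → ℝ)
    (Istim : Fin n → ℝ → ℝ) (a b : ℝ) (u : ℝ → NState n) : Prop :=
  (∀ i, ∃ S, ScalEq (A i) (Istim i) a b (fun s => (u s).1 i) S
    (upX (-1) ε μ c Γ u i) (upX 1 ε μ c Γ u i)) ∧
  (∀ p, ∃ S, ScalEq (B p) (fun _ => 0) a b (fun s => (u s).2 p) S
    (upZ (-1) ε μ d Γ u p) (upZ 1 ε μ d Γ u p))

theorem comp_x {F : ℝ → NState n} {a b : ℝ} (hF : IntegrableOn F (Icc a b)) {t : ℝ}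
    (ht : t ∈ Icc a b) (i : Fin n) : (∫ s in a..t, F s).1 i = ∫ s in a..t, (F s).1 i := by
  have hi : IntervalIntegrable F volume a t := (hF.mono_set
    ((convex_Icc a b).ordConnected.uIcc_subset ⟨le_rfl, ht.1.trans ht.2⟩ ht)).intervalIntegrable
  exact (((ContinuousLinearMap.proj (R := ℝ) (φ := fun _ : Fin n => ℝ) i).comp
    (ContinuousLinearMap.fst ℝ (Fin n → ℝ) (IdxZ n → ℝ))).intervalIntegral_comp_comm hi).symm

theorem comp_z {F : ℝ → NState n} {a b : ℝ} (hF : IntegrableOn F (Icc a b)) {t : ℝ}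
    (ht : t ∈ Icc a b) (p : IdxZ n) : (∫ s in a..t, F s).2 p = ∫ s in a..t, (F s).2 p := by
  have hi : IntervalIntegrable F volume a t := (hF.mono_set
    ((convex_Icc a b).ordConnected.uIcc_subset ⟨le_rfl, ht.1.trans ht.2⟩ ht)).intervalIntegrable
  exact (((ContinuousLinearMap.proj (R := ℝ) (φ := fun _ : IdxZ n => ℝ) p).comp
    (ContinuousLinearMap.snd ℝ (Fin n → ℝ) (IdxZ n → ℝ))).intervalIntegral_comp_comm hi).symm

theorem int_x {F : ℝ → NState n} {a b : ℝ} (hF : IntegrableOn F (Icc a b)) (i : Fin n) :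
    IntegrableOn (fun s => (F s).1 i) (Icc a b) :=
  ((ContinuousLinearMap.proj (R := ℝ) (φ := fun _ : Fin n => ℝ) i).comp
    (ContinuousLinearMap.fst ℝ (Fin n → ℝ) (IdxZ n → ℝ))).integrable_comp hF

theorem int_z {F : ℝ → NState n} {a b : ℝ} (hF : IntegrableOn F (Icc a b)) (p : IdxZ n) :
    IntegrableOn (fun s => (F s).2 p) (Icc a b) :=
  ((ContinuousLinearMap.proj (R := ℝ) (φ := fun _ : IdxZ n => ℝ) p).comp
    (ContinuousLinearMap.snd ℝ (Fin n → ℝ) (IdxZ n → ℝ))).integrable_comp hF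

theorem int_of_comp {F : ℝ → NState n} {a b : ℝ}
    (hx : ∀ i, IntegrableOn (fun s => (F s).1 i) (Icc a b))
    (hz : ∀ p, IntegrableOn (fun s => (F s).2 p) (Icc a b)) : IntegrableOn F (Icc a b) := by
  have h1 : IntegrableOn (fun s => (F s).1) (Icc a b) := Integrable.of_eval hx
  have h2 : IntegrableOn (fun s => (F s).2) (Icc a b) := Integrable.of_eval hz
  exact h1.prodMk h2

variable {μ : IdxZ n → Measure ℝ} [hfin : ∀ p, IsFiniteMeasure ((μ p).restrict (Iic (0 : ℝ)))]
  {A : Fin n → ℝ → ℝ} {B : IdxZ n → ℝ → ℝ} {Istim : Fin n → ℝ → ℝ}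

theorem fwd (hA : ∀ i, Continuous (A i)) (hB : ∀ p, Continuous (B p))
    (hI : ∀ i, Continuous (Istim i)) (c d : IdxZ n → ℝ) (Γ : Fin n → ℝ) {e : ℝ}
    (he : e ∈ Icc (0 : ℝ) (1 / 5)) {a b : ℝ} {u₀ u w : ℝ → NState n} (hw : Continuous w)
    (huw : ∀ t ≤ b, u t = w t)
    (hsol : IsIncSolOn e A B μ c d Γ Istim a b u₀ u) :
    CompSol e A B μ c d Γ Istim a b w := by
  obtain ⟨h0, -, S, hS, hint, heq⟩ := hsol
  have hu00 : u₀ 0 = u a := by rw [← h0 0 le_rfl, add_zero]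
  have hS' : ∀ t ∈ Icc a b, S t ∈ Xset e μ c d Γ (hist w t) := fun t ht =>
    Xset_congr e c d Γ (fun s hs => huw _ (by linarith [ht.2])) (hS t ht)
  simp only [Xset_iff he c d Γ hw] at hS'
  have hiX : ∀ i, IntegrableOn (fun s => (-(A i ((w s).1 i)) * (w s).1 i + Istim i s) + (S s).1 i)
      (Icc a b) := by
    intro i
    refine (int_x hint i).congr_fun (fun s hs => ?_) measurableSet_Icc
    simp [decayT, hist, stimT, huw s hs.2]; ring
  have hiZ : ∀ p, IntegrableOn (fun s => (-(B p ((w s).2 p)) * (w s).2 p + 0) + (S s).2 p)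
      (Icc a b) := by
    intro p
    refine (int_z hint p).congr_fun (fun s hs => ?_) measurableSet_Icc
    simp [decayT, hist, stimT, huw s hs.2]
  constructor
  · intro i
    refine ⟨fun s => (S s).1 i, ?_, fun t ht => (hS' t ht).1 i, fun t ht => ?_⟩
    · have hc : Continuous fun s => -(A i ((w s).1 i)) * (w s).1 i + Istim i s :=
        (((hA i).comp (cont_x hw i)).neg.mul (cont_x hw i)).add (hI i)
      have := (hiX i).sub (hc.continuousOn.integrableOn_compact isCompact_Icc)
      refine this.congr_fun (fun s _ => ?_) measurableSet_Icc
      simp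
    · have hsub : uIcc a t ⊆ Icc a b :=
        (convex_Icc a b).ordConnected.uIcc_subset ⟨le_rfl, ht.1.trans ht.2⟩ ht
      have := congrArg (fun v : NState n => v.1 i) (heq t ht)
      simp only [Prod.fst_add, Pi.add_apply] at this
      rw [comp_x hint ht i, hu00, huw t ht.2, huw a (ht.1.trans ht.2)] at this
      refine this.trans ?_
      congr 1
      refine intervalIntegral.integral_congr fun s hs => ?_
      simp [decayT, hist, stimT, huw s (hsub hs).2]; ring
  · intro p
    refine ⟨fun s => (S s).2 p, ?_, fun t ht => (hS' t ht).2 p, fun t ht => ?_⟩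
    · have hc : Continuous fun s => -(B p ((w s).2 p)) * (w s).2 p + 0 :=
        (((hB p).comp (cont_z hw p)).neg.mul (cont_z hw p)).add continuous_const
      have := (hiZ p).sub (hc.continuousOn.integrableOn_compact isCompact_Icc)
      refine this.congr_fun (fun s _ => ?_) measurableSet_Icc
      simp
    · have hsub : uIcc a t ⊆ Icc a b :=
        (convex_Icc a b).ordConnected.uIcc_subset ⟨le_rfl, ht.1.trans ht.2⟩ ht
      have := congrArg (fun v : NState n => v.2 p) (heq t ht)
      simp only [Prod.snd_add, Pi.add_apply] at this
      rw [comp_z hint ht p, hu00, huw t ht.2, huw a (ht.1.trans ht.2)] at this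
      refine this.trans ?_
      congr 1
      refine intervalIntegral.integral_congr fun s hs => ?_
      simp [decayT, hist, stimT, huw s (hsub hs).2]

theorem bwd (hA : ∀ i, Continuous (A i)) (hB : ∀ p, Continuous (B p))
    (hI : ∀ i, Continuous (Istim i)) (c d : IdxZ n → ℝ) (Γ : Fin n → ℝ) {e : ℝ}
    (he : e ∈ Icc (0 : ℝ) (1 / 5)) {a b : ℝ} {u₀ w : ℝ → NState n} (hw : Continuous w)
    (hw0 : ∀ s ≤ 0, w (a + s) = u₀ s)
    (hsol : CompSol e A B μ c d Γ Istim a b w) :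
    IsIncSolOn e A B μ c d Γ Istim a b u₀ w := by
  obtain ⟨h1, h2⟩ := hsol
  choose Sx iSx bSx eSx using h1
  choose Sz iSz bSz eSz using h2
  have hu00 : u₀ 0 = w a := by rw [← hw0 0 le_rfl, add_zero]
  have hint : IntegrableOn (fun s => decayT A B (hist w s) +
      ((fun i => Sx i s, fun p => Sz p s) : NState n) + stimT Istim s) (Icc a b) := by
    refine int_of_comp (fun i => ?_) (fun p => ?_)
    · have hc : Continuous fun s => -(A i ((w s).1 i)) * (w s).1 i + Istim i s :=
        (((hA i).comp (cont_x hw i)).neg.mul (cont_x hw i)).add (hI i)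
      refine ((hc.continuousOn.integrableOn_compact isCompact_Icc).add (iSx i)).congr_fun
        (fun s _ => ?_) measurableSet_Icc
      simp [decayT, hist, stimT]; ring
    · have hc : Continuous fun s => -(B p ((w s).2 p)) * (w s).2 p + 0 :=
        (((hB p).comp (cont_z hw p)).neg.mul (cont_z hw p)).add continuous_const
      refine ((hc.continuousOn.integrableOn_compact isCompact_Icc).add (iSz p)).congr_fun
        (fun s _ => ?_) measurableSet_Icc
      simp [decayT, hist, stimT]
  refine ⟨hw0, hw.continuousOn, fun s => (fun i => Sx i s, fun p => Sz p s), ?_, hint, ?_⟩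
  · intro t ht
    rw [Xset_iff he c d Γ hw]
    exact ⟨fun i => bSx i t ht, fun p => bSz p t ht⟩
  · intro t ht
    rw [hu00]
    refine Prod.ext (funext fun i => ?_) (funext fun p => ?_)
    · rw [Prod.fst_add, Pi.add_apply, comp_x hint ht i]
      refine (eSx i t ht).trans ?_
      congr 1
      refine intervalIntegral.integral_congr fun s hs => ?_
      simp [decayT, hist, stimT]; ring
    · rw [Prod.snd_add, Pi.add_apply, comp_z hint ht p]
      refine (eSz p t ht).trans ?_
      congr 1
      refine intervalIntegral.integral_congr fun s hs => ?_
      simp [decayT, hist, stimT]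

end

/-- Limit passage in the scalar equation. -/
theorem scal_limit {a b : ℝ} (hab : a ≤ b) {A I : ℝ → ℝ} (hA : Continuous A) (hI : Continuous I)
    (x : ℕ → ℝ → ℝ) (x0 : ℝ → ℝ) (hx : ∀ m, Continuous (x m)) (hx0 : Continuous x0) (R : ℝ)
    (hR : ∀ m, ∀ t ∈ Icc a b, |x m t| ≤ R)
    (hxl : ∀ t ∈ Icc a b, Tendsto (fun m => x m t) atTop (𝓝 (x0 t)))
    (S lo hi : ℕ → ℝ → ℝ) (lo0 hi0 : ℝ → ℝ) (K : ℝ)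
    (hS : ∀ m, ScalEq A I a b (x m) (S m) (lo m) (hi m))
    (mlo : ∀ m, Measurable (lo m)) (mlo0 : Measurable lo0)
    (mhi : ∀ m, Measurable (hi m)) (mhi0 : Measurable hi0)
    (blo : ∀ m, ∀ t ∈ Icc a b, |lo m t| ≤ K) (blo0 : ∀ t ∈ Icc a b, |lo0 t| ≤ K)
    (bhi : ∀ m, ∀ t ∈ Icc a b, |hi m t| ≤ K) (bhi0 : ∀ t ∈ Icc a b, |hi0 t| ≤ K)
    (hlimlo : ∀ t ∈ Icc a b, Tendsto (fun m => max (lo m t - lo0 t) 0) atTop (𝓝 0))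
    (hlim : ∀ t ∈ Icc a b, Tendsto (fun m => max (hi m t - hi0 t) 0) atTop (𝓝 0))
    (hlh : ∀ t ∈ Icc a b, -lo0 t ≤ hi0 t) :
    ∃ S0, ScalEq A I a b x0 S0 lo0 hi0 := by
  have haI : a ∈ Icc a b := ⟨le_rfl, hab⟩
  have hsub : ∀ {t}, t ∈ Icc a b → uIcc a t ⊆ Icc a b := fun ht =>
    (convex_Icc a b).ordConnected.uIcc_subset haI ht
  have hc : ∀ y : ℝ → ℝ, Continuous y → Continuous fun s => -(A (y s)) * y s + I s := fun y hy =>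
    ((hA.comp hy).neg.mul hy).add hI
  have hii : ∀ m, ∀ t ∈ Icc a b, IntervalIntegrable (S m) volume a t := fun m t ht =>
    ((hS m).1.mono_set (hsub ht)).intervalIntegrable
  obtain ⟨C1, hC1⟩ := (isCompact_Icc (a := -R) (b := R)).exists_bound_of_continuousOn
    (f := fun y => -(A y) * y) (hA.neg.mul continuous_id).continuousOn
  obtain ⟨C2, hC2⟩ := (isCompact_Icc (a := a) (b := b)).exists_bound_of_continuousOn
    hI.continuousOn
  have hv : ∀ t ∈ Icc a b, Tendsto (fun m => ∫ s in a..t, S m s) atTop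
      (𝓝 (x0 t - x0 a - ∫ s in a..t, (-(A (x0 s)) * x0 s + I s))) := by
    intro t ht
    have e1 : ∀ m, x m t - x m a - ∫ s in a..t, (-(A (x m s)) * x m s + I s) =
        ∫ s in a..t, S m s := by
      intro m
      rw [(hS m).2.2 t ht, intervalIntegral.integral_add ((hc _ (hx m)).intervalIntegrable _ _)
        (hii m t ht)]
      ring
    refine Tendsto.congr e1 (((hxl t ht).sub (hxl a haI)).sub ?_)
    refine intervalIntegral.tendsto_integral_filter_of_dominated_convergence (fun _ => C1 + C2)
      ?_ ?_ ?_ ?_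
    · exact Eventually.of_forall fun m => (hc _ (hx m)).aestronglyMeasurable
    · refine Eventually.of_forall fun m => Eventually.of_forall fun s hs => ?_
      have hs' := hsub ht (uIoc_subset_uIcc hs)
      exact (norm_add_le _ _).trans (add_le_add (hC1 _ (abs_le.1 (hR m s hs'))) (hC2 s hs'))
    · exact intervalIntegrable_const
    · refine Eventually.of_forall fun s hs => ?_
      have hs' := hsub ht (uIoc_subset_uIcc hs)
      have hl := hxl s hs'
      exact ((((hA.tendsto _).comp hl).neg).mul hl).add tendsto_const_nhds
  obtain ⟨S0, i0, b0, e0⟩ := core hab S lo hi lo0 hi0 _ K (fun m => (hS m).1)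
    (fun m => (hS m).2.1) mlo mlo0 mhi mhi0 blo blo0 bhi bhi0 hlimlo hlim hlh hv
  refine ⟨S0, i0, b0, fun t ht => ?_⟩
  have := e0 t ht
  rw [intervalIntegral.integral_add ((hc _ hx0).intervalIntegrable _ _)
    ((i0.mono_set (hsub ht)).intervalIntegrable), ← this]
  ring


/-- One-sided a priori bound for the scalar equation. -/
theorem apr_pos {a b : ℝ} {A x h G : ℝ → ℝ} (hA : Continuous A) (hA0 : ∀ s, 0 ≤ A s)
    (hx : Continuous x) (hG : Continuous G) (hG0 : ∀ s, 0 ≤ G s) (hint : IntegrableOn h (Icc a b))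
    (hh : ∀ s ∈ Icc a b, h s ≤ G s)
    (heq : ∀ t ∈ Icc a b, x t = x a + ∫ s in a..t, (-(A (x s)) * x s + h s)) {t : ℝ}
    (ht : t ∈ Icc a b) : x t ≤ |x a| + ∫ s in a..t, G s := by
  have hGi : ∀ p q, p ≤ q → 0 ≤ ∫ s in p..q, G s := fun p q hpq =>
    intervalIntegral.integral_nonneg hpq fun s _ => hG0 s
  have hex : ∃ s0 ∈ Icc a t, x s0 ≤ |x a| ∧ (x t ≤ 0 ∨ ∀ s ∈ Ioc s0 t, 0 ≤ x s) := by
    by_cases hne : {s | s ∈ Icc a t ∧ x s ≤ 0}.Nonempty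
    · have hcp : IsCompact {s | s ∈ Icc a t ∧ x s ≤ 0} :=
        isCompact_Icc.inter_right (isClosed_le hx continuous_const)
      have hm := hcp.sSup_mem hne
      refine ⟨_, hm.1, hm.2.trans (abs_nonneg _), Or.inr fun s hs => ?_⟩
      by_contra hc
      have : s ≤ sSup {s | s ∈ Icc a t ∧ x s ≤ 0} :=
        le_csSup hcp.bddAbove ⟨⟨hm.1.1.trans hs.1.le, hs.2⟩, (not_le.1 hc).le⟩
      exact absurd hs.1 (not_lt.2 this)
    · refine ⟨a, ⟨le_rfl, ht.1⟩, le_abs_self _, Or.inr fun s hs => ?_⟩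
      by_contra hc
      exact hne ⟨s, ⟨hs.1.le, hs.2⟩, (not_le.1 hc).le⟩
  obtain ⟨s0, hs0, hxs0, h1 | h1⟩ := hex
  · have := hGi a t ht.1
    have := abs_nonneg (x a)
    linarith
  have hs0b : s0 ∈ Icc a b := ⟨hs0.1, hs0.2.trans ht.2⟩
  have hc : Continuous fun s => -(A (x s)) * x s := ((hA.comp hx).neg.mul hx)
  have hF : IntegrableOn (fun s => -(A (x s)) * x s + h s) (Icc a b) :=
    (hc.continuousOn.integrableOn_compact isCompact_Icc).add hint
  have hi : ∀ p ∈ Icc a b, ∀ q ∈ Icc a b,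
      IntervalIntegrable (fun s => -(A (x s)) * x s + h s) volume p q := fun p hp q hq =>
    (hF.mono_set ((convex_Icc a b).ordConnected.uIcc_subset hp hq)).intervalIntegrable
  have ha : a ∈ Icc a b := ⟨le_rfl, ht.1.trans ht.2⟩
  have e1 := heq t ht
  have e2 := heq s0 hs0b
  have e3 := intervalIntegral.integral_add_adjacent_intervals (hi a ha s0 hs0b) (hi s0 hs0b t ht)
  have e4 := intervalIntegral.integral_add_adjacent_intervals
    (hG.intervalIntegrable (μ := volume) a s0) (hG.intervalIntegrable (μ := volume) s0 t)
  have e5 := hGi a s0 hs0.1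
  have e6 : ∫ s in s0..t, (-(A (x s)) * x s + h s) ≤ ∫ s in s0..t, G s := by
    refine intervalIntegral.integral_mono_on_of_le_Ioo hs0.2 (hi s0 hs0b t ht)
      (hG.intervalIntegrable _ _) fun s hs => ?_
    have := hh s ⟨hs0.1.trans hs.1.le, hs.2.le.trans ht.2⟩
    have := mul_nonneg (hA0 (x s)) (h1 s ⟨hs.1, hs.2.le⟩)
    linarith
  linarith

theorem apr_abs {a b : ℝ} {A x h G : ℝ → ℝ} (hA : Continuous A) (hA0 : ∀ s, 0 ≤ A s)
    (hx : Continuous x) (hG : Continuous G) (hG0 : ∀ s, 0 ≤ G s) (hint : IntegrableOn h (Icc a b))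
    (hh : ∀ s ∈ Icc a b, |h s| ≤ G s)
    (heq : ∀ t ∈ Icc a b, x t = x a + ∫ s in a..t, (-(A (x s)) * x s + h s)) {t : ℝ}
    (ht : t ∈ Icc a b) : |x t| ≤ |x a| + ∫ s in a..t, G s := by
  refine abs_le.2 ⟨?_, apr_pos hA hA0 hx hG hG0 hint (fun s hs => (abs_le.1 (hh s hs)).2) heq ht⟩
  have := apr_pos (A := fun s => A (-s)) (x := fun s => -x s) (h := fun s => -h s)
    (hA.comp continuous_neg) (fun s => hA0 _) hx.neg hG hG0 hint.neg
    (fun s hs => by linarith [(abs_le.1 (hh s hs)).1]) (fun t ht => ?_) ht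
  · rw [abs_neg] at this; linarith
  · simp only [neg_neg]
    rw [heq t ht, neg_add, ← intervalIntegral.integral_neg]
    congr 1
    refine intervalIntegral.integral_congr fun s _ => ?_
    ring

/-- Integral form of Gronwall. -/
theorem gron {a b r K : ℝ} (hr : 0 ≤ r) (hK : 0 ≤ K) {φ : ℝ → ℝ} (hφ : Continuous φ)
    (hφ0 : ∀ t, 0 ≤ φ t)
    (h : ∀ t ∈ Icc a b, φ t ≤ r + ∫ s in a..t, K * (φ s + 1)) :
    ∀ t ∈ Icc a b, φ t ≤ gronwallBound r K K (t - a) := by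
  have hG : Continuous fun s => K * (φ s + 1) := by fun_prop
  have hG0 : ∀ s, 0 ≤ K * (φ s + 1) := fun s => mul_nonneg hK (by linarith [hφ0 s])
  have hd : ∀ t, HasDerivAt (fun t => r + ∫ s in a..t, K * (φ s + 1)) (K * (φ t + 1)) t := fun t =>
    (intervalIntegral.integral_hasDerivAt_right (hG.intervalIntegrable _ _)
      hG.aestronglyMeasurable.stronglyMeasurableAtFilter hG.continuousAt).const_add r
  have := norm_le_gronwallBound_of_norm_deriv_right_le (a := a) (b := b) (δ := r) (K := K) (ε := K)
    (f := fun t => r + ∫ s in a..t, K * (φ s + 1)) (f' := fun t => K * (φ t + 1))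
    (fun t _ => (hd t).continuousAt.continuousWithinAt) (fun t _ => (hd t).hasDerivWithinAt)
    (by simp [abs_of_nonneg hr]) (fun t ht => by
      have h1 := h t ⟨ht.1, ht.2.le⟩
      rw [Real.norm_of_nonneg (hG0 t)]
      have h2 := (h1.trans (le_abs_self _))
      rw [Real.norm_eq_abs]
      nlinarith)
  intro t ht
  exact (h t ht).trans ((le_abs_self _).trans (this t ht))

theorem gron_bd (r K a b : ℝ) : ∃ R, ∀ t ∈ Icc a b, gronwallBound r K K (t - a) ≤ R := by
  have hc : Continuous fun t => gronwallBound r K K (t - a) :=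
    continuous_iff_continuousAt.2 fun t => (hasDerivAt_gronwallBound_shift r K K t a).continuousAt
  obtain ⟨R, hR⟩ := (isCompact_Icc (a := a) (b := b)).exists_bound_of_continuousOn hc.continuousOn
  exact ⟨R, fun t ht => (le_abs_self _).trans (hR t ht)⟩

/-- Lipschitz bound for the scalar equation. -/
theorem scal_lip {a b : ℝ} {F x : ℝ → ℝ} {C : ℝ} (hF : IntegrableOn F (Icc a b))
    (hC : ∀ s ∈ Icc a b, |F s| ≤ C) (heq : ∀ t ∈ Icc a b, x t = x a + ∫ s in a..t, F s) :
    ∀ s ∈ Icc a b, ∀ t ∈ Icc a b, |x t - x s| ≤ C * |t - s| := by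
  intro s hs t ht
  have ha : a ∈ Icc a b := ⟨le_rfl, hs.1.trans hs.2⟩
  have hi : ∀ p ∈ Icc a b, ∀ q ∈ Icc a b, IntervalIntegrable F volume p q := fun p hp q hq =>
    (hF.mono_set ((convex_Icc a b).ordConnected.uIcc_subset hp hq)).intervalIntegrable
  have e3 := intervalIntegral.integral_add_adjacent_intervals (hi a ha s hs) (hi s hs t ht)
  have : x t - x s = ∫ r in s..t, F r := by
    rw [heq t ht, heq s hs, ← e3]; ring
  rw [this]
  exact intervalIntegral.norm_integral_le_of_norm_le_const (f := F) (C := C) fun r hr =>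
    hC r ((convex_Icc a b).ordConnected.uIcc_subset hs ht (uIoc_subset_uIcc hr))

section
variable {n : ℕ}

theorem st_le {v : NState n} {C : ℝ} (hC : 0 ≤ C) (h1 : ∀ i, |v.1 i| ≤ C) (h2 : ∀ p, |v.2 p| ≤ C) :
    ‖v‖ ≤ C :=
  norm_prod_le_iff.2 ⟨(pi_norm_le_iff_of_nonneg hC).2 h1, (pi_norm_le_iff_of_nonneg hC).2 h2⟩

variable {μ : IdxZ n → Measure ℝ} [hfin : ∀ p, IsFiniteMeasure ((μ p).restrict (Iic (0 : ℝ)))]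
  {A : Fin n → ℝ → ℝ} {B : IdxZ n → ℝ → ℝ} {Istim : Fin n → ℝ → ℝ}

theorem comp_bound (hA : ∀ i, Continuous (A i)) (hB : ∀ p, Continuous (B p))
    (hA0 : ∀ i s, 0 ≤ A i s) (hB0 : ∀ i s, 0 ≤ B i s)
    (hI : ∀ i, Continuous (Istim i)) (c d : IdxZ n → ℝ) (Γ : Fin n → ℝ) {a b r : ℝ}
    (hr : 0 ≤ r) :
    ∃ R L, 0 ≤ R ∧ 0 ≤ L ∧ ∀ e ∈ Icc (0 : ℝ) (1 / 5), ∀ w : ℝ → NState n, Continuous w → ‖w a‖ ≤ r →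
      CompSol e A B μ c d Γ Istim a b w →
      (∀ t ∈ Icc a b, ‖w t‖ ≤ R) ∧ ∀ s ∈ Icc a b, ∀ t ∈ Icc a b, ‖w t - w s‖ ≤ L * |t - s| := by
  obtain ⟨K, hK0, hK⟩ := up_bd (μ := μ) c d Γ
  have hIv : Continuous fun t i => Istim i t := continuous_pi hI
  obtain ⟨KI', hKI'⟩ := (isCompact_Icc (a := a) (b := b)).exists_bound_of_continuousOn
    hIv.continuousOn
  obtain ⟨KI, hKI0, hKI⟩ : ∃ KI, 0 ≤ KI ∧ ∀ t ∈ Icc a b, ∀ i, |Istim i t| ≤ KI :=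
    ⟨max KI' 0, le_max_right _ _, fun t ht i =>
      (norm_le_pi_norm (fun i => Istim i t) i).trans ((hKI' t ht).trans (le_max_left _ _))⟩
  obtain ⟨R', hR'⟩ := gron_bd r (K + KI) a b
  obtain ⟨R, hR0, hR⟩ : ∃ R, 0 ≤ R ∧ ∀ t ∈ Icc a b, gronwallBound r (K + KI) (K + KI) (t - a) ≤ R :=
    ⟨max R' 0, le_max_right _ _, fun t ht => (hR' t ht).trans (le_max_left _ _)⟩
  have hAv : Continuous fun (y : ℝ) i => -(A i y) * y :=
    continuous_pi fun i => (hA i).neg.mul continuous_id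
  have hBv : Continuous fun (y : ℝ) p => -(B p y) * y :=
    continuous_pi fun i => (hB i).neg.mul continuous_id
  obtain ⟨CA, hCA⟩ := (isCompact_Icc (a := -R) (b := R)).exists_bound_of_continuousOn
    hAv.continuousOn
  obtain ⟨CB, hCB⟩ := (isCompact_Icc (a := -R) (b := R)).exists_bound_of_continuousOn
    hBv.continuousOn
  have hCA' : ∀ y, |y| ≤ R → ∀ i, |-(A i y) * y| ≤ CA := fun y hy i =>
    (norm_le_pi_norm (fun i => -(A i y) * y) i).trans (hCA y (abs_le.1 hy))
  have hCB' : ∀ y, |y| ≤ R → ∀ i, |-(B i y) * y| ≤ CB := fun y hy i =>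
    (norm_le_pi_norm (fun i => -(B i y) * y) i).trans (hCB y (abs_le.1 hy))
  have hL0 : 0 ≤ |CA| + |CB| + KI + K * (R + 1) := by positivity
  refine ⟨R, |CA| + |CB| + KI + K * (R + 1), hR0, hL0, ?_⟩
  rintro e he w hw hwa ⟨hX, hZ⟩
  choose Sx iSx bSx eSx using hX
  choose Sz iSz bSz eSz using hZ
  have hm1 : |(-1 : ℝ)| = 1 := by simp
  have hSx : ∀ i, ∀ t ∈ Icc a b, |Sx i t| ≤ K * (‖w t‖ + 1) := fun i t ht => by
    have h1 := abs_le.1 ((hK 1 (by simp) e he w hw t).1 i)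
    have h2 := abs_le.1 ((hK (-1) hm1 e he w hw t).1 i)
    have h3 := bSx i t ht
    exact abs_le.2 ⟨by linarith, by linarith⟩
  have hSz : ∀ i, ∀ t ∈ Icc a b, |Sz i t| ≤ K * (‖w t‖ + 1) := fun i t ht => by
    have h1 := abs_le.1 ((hK 1 (by simp) e he w hw t).2 i)
    have h2 := abs_le.1 ((hK (-1) hm1 e he w hw t).2 i)
    have h3 := bSz i t ht
    exact abs_le.2 ⟨by linarith, by linarith⟩
  have hG : Continuous fun s => (K + KI) * (‖w s‖ + 1) := by fun_prop
  have hG0 : ∀ s, 0 ≤ (K + KI) * (‖w s‖ + 1) := fun s => by positivity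
  have hIi : ∀ i, IntegrableOn (Istim i) (Icc a b) := fun i =>
    (hI i).continuousOn.integrableOn_compact isCompact_Icc
  have hφ : ∀ t ∈ Icc a b, ‖w t‖ ≤ r + ∫ s in a..t, (K + KI) * (‖w s‖ + 1) := by
    intro t ht
    have hnn : 0 ≤ ∫ s in a..t, (K + KI) * (‖w s‖ + 1) :=
      intervalIntegral.integral_nonneg ht.1 fun s _ => hG0 s
    refine st_le (by linarith) (fun i => ?_) (fun p => ?_)
    · have := apr_abs (h := fun s => Istim i s + Sx i s) (hA i) (hA0 i) (cont_x hw i) hG hG0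
        ((hIi i).add (iSx i)) (fun s hs => ?_) (fun t ht => ?_) ht
      · exact this.trans (add_le_add_left ((abs_x _ i).trans hwa) _)
      · have h1 := hSx i s hs
        have h2 := hKI s hs i
        have h3 := abs_add_le (Istim i s) (Sx i s)
        have h4 := mul_nonneg hKI0 (norm_nonneg (w s))
        nlinarith
      · refine (eSx i t ht).trans ?_
        simp only [add_assoc]
    · have := apr_abs (h := fun s => Sz p s) (hB p) (hB0 p) (cont_z hw p) hG hG0
        (iSz p) (fun s hs => ?_) (fun t ht => ?_) ht
      · exact this.trans (add_le_add_left ((abs_z _ p).trans hwa) _)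
      · have h1 := hSz p s hs
        have h4 := mul_nonneg hKI0 (norm_nonneg (w s))
        nlinarith
      · refine (eSz p t ht).trans ?_
        simp only [add_zero]
  have hwR : ∀ t ∈ Icc a b, ‖w t‖ ≤ R := fun t ht =>
    (gron hr (by positivity) hw.norm (fun _ => norm_nonneg _) hφ t ht).trans (hR t ht)
  refine ⟨hwR, fun s hs t ht => ?_⟩
  refine st_le (by positivity) (fun i => ?_) (fun p => ?_)
  · have hc : Continuous fun s => -(A i ((w s).1 i)) * (w s).1 i + Istim i s :=
        (((hA i).comp (cont_x hw i)).neg.mul (cont_x hw i)).add (hI i)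
    refine scal_lip (x := fun s => (w s).1 i)
      ((hc.continuousOn.integrableOn_compact isCompact_Icc).add (iSx i)) (fun s hs => ?_) (eSx i)
      s hs t ht
    have h1 := hSx i s hs
    have h2 := hKI s hs i
    have h3 := abs_add_three (-(A i ((w s).1 i)) * (w s).1 i) (Istim i s) (Sx i s)
    have h4 := hCA' _ ((abs_x (w s) i).trans (hwR s hs)) i
    have h5 := mul_le_mul_of_nonneg_left (add_le_add_left (hwR s hs) 1) hK0
    have h6 := le_abs_self CA
    have h7 := abs_nonneg CB
    refine h3.trans ?_
    linarith
  · have hc : Continuous fun s => -(B p ((w s).2 p)) * (w s).2 p + 0 :=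
        (((hB p).comp (cont_z hw p)).neg.mul (cont_z hw p)).add continuous_const
    refine scal_lip (x := fun s => (w s).2 p)
      ((hc.continuousOn.integrableOn_compact isCompact_Icc).add (iSz p)) (fun s hs => ?_) (eSz p)
      s hs t ht
    have h1 := hSz p s hs
    have h3 := abs_add_three (-(B p ((w s).2 p)) * (w s).2 p) 0 (Sz p s)
    have h4 := hCB' _ ((abs_z (w s) p).trans (hwR s hs)) p
    have h5 := mul_le_mul_of_nonneg_left (add_le_add_left (hwR s hs) 1) hK0
    have h6 := le_abs_self CB
    have h7 := abs_nonneg CA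
    refine h3.trans ?_
    rw [abs_zero]
    linarith

end

/-- Arzela-Ascoli for uniformly Lipschitz sequences on a compact interval. -/
theorem arz {E : Type*} [NormedAddCommGroup E] [ProperSpace E] {a b : ℝ} (hab : a ≤ b)
    (w : ℕ → ℝ → E) (R L : ℝ) (hL : 0 ≤ L) (hR : ∀ m, ∀ t ∈ Icc a b, ‖w m t‖ ≤ R)
    (hLip : ∀ m, ∀ s ∈ Icc a b, ∀ t ∈ Icc a b, ‖w m t - w m s‖ ≤ L * |t - s|) :
    ∃ φ : ℕ → ℕ, StrictMono φ ∧ ∃ g : ℝ → E, Continuous g ∧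
      TendstoUniformlyOn (fun k => w (φ k)) g atTop (Icc a b) := by
  have hlw : ∀ m, LipschitzWith L.toNNReal (fun t : Icc a b => w m t.1) := fun m =>
    LipschitzWith.of_dist_le_mul fun s t => by
      rw [Real.coe_toNNReal _ hL, dist_eq_norm, Subtype.dist_eq, Real.dist_eq]
      exact hLip m t.1 t.2 s.1 s.2
  let f : ℕ → BoundedContinuousFunction (Icc a b) E := fun m =>
    BoundedContinuousFunction.mkOfCompact ⟨fun t => w m t.1, (hlw m).continuous⟩
  have hcp : IsCompact (closure (range f)) := by
    refine BoundedContinuousFunction.arzela_ascoli (Metric.closedBall 0 R)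
      (isCompact_closedBall _ _) _ ?_ ?_
    · rintro _ t ⟨m, rfl⟩
      exact mem_closedBall_zero_iff.2 (hR m t.1 t.2)
    · refine LipschitzWith.uniformEquicontinuous _ L.toNNReal ?_ |>.equicontinuous
      rintro ⟨_, m, rfl⟩
      exact hlw m
  obtain ⟨g, -, φ, hφ, hg⟩ := hcp.tendsto_subseq (x := f) fun m => subset_closure ⟨m, rfl⟩
  refine ⟨φ, hφ, IccExtend hab g, g.continuous.Icc_extend', ?_⟩
  rw [BoundedContinuousFunction.tendsto_iff_tendstoUniformly] at hg
  rw [Metric.tendstoUniformly_iff] at hg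
  rw [Metric.tendstoUniformlyOn_iff]
  intro δ hδ
  filter_upwards [hg δ hδ] with k hk t ht
  rw [IccExtend_of_mem hab _ ht]
  exact hk ⟨t, ht⟩

theorem glue_cont {E : Type*} [TopologicalSpace E] {t₀ : ℝ} {v w : ℝ → E}
    (hv : ContinuousOn v (Iic 0)) (hw : ContinuousOn w (Ici t₀)) (h : v 0 = w t₀) :
    Continuous fun t => if t ≤ t₀ then v (t - t₀) else w t := by
  refine continuous_if_le continuous_id continuous_const ?_ ?_ ?_
  · exact hv.comp (by fun_prop) fun t ht => by simpa using ht
  · exact hw.mono fun t ht => ht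
  · rintro t rfl
    simpa using h

theorem hypM_fin {n : ℕ} {γ : ℝ} (hγ : 0 < γ) {μ : IdxZ n → Measure ℝ} (hM : HypM γ μ)
    (p : IdxZ n) : IsFiniteMeasure ((μ p).restrict (Iic (0 : ℝ))) := by
  refine ⟨lt_of_le_of_lt ?_ (hM p)⟩
  rw [← lintegral_one]
  refine setLIntegral_mono' measurableSet_Iic fun t ht => ?_
  rw [← ENNReal.ofReal_one]
  refine ENNReal.ofReal_le_ofReal (Real.one_le_exp ?_)
  have : t ≤ 0 := ht
  nlinarith

theorem gNorm_pt {E : Type*} [NormedAddCommGroup E] {γ : ℝ} {v : ℝ → E}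
    (h : BddAbove (range fun t : Iic (0 : ℝ) => Real.exp (γ * t.1) * ‖v t.1‖)) {s : ℝ}
    (hs : s ≤ 0) : Real.exp (γ * s) * ‖v s‖ ≤ gNorm γ v :=
  le_ciSup h ⟨s, hs⟩

theorem bdd_sub {E : Type*} [NormedAddCommGroup E] {γ : ℝ} {v w : ℝ → E}
    (h : BddAbove (range fun t : Iic (0 : ℝ) => Real.exp (γ * t.1) * ‖v t.1‖))
    (h' : BddAbove (range fun t : Iic (0 : ℝ) => Real.exp (γ * t.1) * ‖w t.1‖)) :
    BddAbove (range fun t : Iic (0 : ℝ) => Real.exp (γ * t.1) * ‖v t.1 - w t.1‖) := by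
  obtain ⟨C, hC⟩ := h
  obtain ⟨C', hC'⟩ := h'
  refine ⟨C + C', ?_⟩
  rintro _ ⟨t, rfl⟩
  have h1 := hC ⟨t, rfl⟩
  have h2 := hC' ⟨t, rfl⟩
  have h3 := mul_le_mul_of_nonneg_left (norm_sub_le (v t.1) (w t.1)) (Real.exp_pos (γ * t.1)).le
  simp only at h1 h2 ⊢
  linarith

theorem gconv {E : Type*} [NormedAddCommGroup E] {γ : ℝ} {v : ℕ → ℝ → E} {w : ℝ → E}
    (h : ∀ m, BddAbove (range fun t : Iic (0 : ℝ) => Real.exp (γ * t.1) * ‖v m t.1‖))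
    (h' : BddAbove (range fun t : Iic (0 : ℝ) => Real.exp (γ * t.1) * ‖w t.1‖))
    (hc : Tendsto (fun m => gNorm γ (fun s => v m s - w s)) atTop (𝓝 0)) {s : ℝ} (hs : s ≤ 0) :
    Tendsto (fun m => v m s) atTop (𝓝 (w s)) := by
  rw [tendsto_iff_norm_sub_tendsto_zero]
  have h1 := hc.const_mul (Real.exp (γ * s))⁻¹
  rw [mul_zero] at h1
  refine squeeze_zero (fun _ => norm_nonneg _) (fun m => ?_) h1
  rw [le_inv_mul_iff₀ (Real.exp_pos _)]
  exact gNorm_pt (v := fun s => v m s - w s) (bdd_sub (h m) h') hs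

section
variable {n : ℕ}
variable {μ : IdxZ n → Measure ℝ} [hfin : ∀ p, IsFiniteMeasure ((μ p).restrict (Iic (0 : ℝ)))]
  {A : Fin n → ℝ → ℝ} {B : IdxZ n → ℝ → ℝ} {Istim : Fin n → ℝ → ℝ}

/-- Closedness: pointwise bounded limits of solutions are solutions. -/
theorem comp_limit (hA : ∀ i, Continuous (A i)) (hB : ∀ p, Continuous (B p))
    (hI : ∀ i, Continuous (Istim i)) (c d : IdxZ n → ℝ) (Γ : Fin n → ℝ) {a b R : ℝ} (hab : a ≤ b)
    {e : ℕ → ℝ} {e0 : ℝ} (he : ∀ m, e m ∈ Icc (0 : ℝ) (1 / 5))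
    (he0 : e0 ∈ Icc (0 : ℝ) (1 / 5)) (h : Tendsto e atTop (𝓝 e0))
    {u : ℕ → ℝ → NState n} {u0 : ℝ → NState n} (hu : ∀ m, Continuous (u m)) (hu0 : Continuous u0)
    (hR : ∀ m, ∀ t ∈ Icc a b, ‖u m t‖ ≤ R)
    (hl : ∀ s ≤ b, Tendsto (fun m => u m s) atTop (𝓝 (u0 s)))
    (hsol : ∀ m, CompSol (e m) A B μ c d Γ Istim a b (u m)) :
    CompSol e0 A B μ c d Γ Istim a b u0 := by
  obtain ⟨K, hK0, hK⟩ := up_bd (μ := μ) c d Γ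
  have hm1 : |(-1 : ℝ)| = 1 := by simp
  have h1 : |(1 : ℝ)| = 1 := by simp
  have hR0 : ∀ t ∈ Icc a b, ‖u0 t‖ ≤ R := fun t ht =>
    le_of_tendsto (hl t ht.2).norm (Eventually.of_forall fun m => hR m t ht)
  have hKm : ∀ v : NState n, ‖v‖ ≤ R → K * (‖v‖ + 1) ≤ K * (R + 1) := fun v hv =>
    mul_le_mul_of_nonneg_left (add_le_add_left hv 1) hK0
  have hlt : ∀ t ∈ Icc a b, ∀ s ≤ t, Tendsto (fun m => u m s) atTop (𝓝 (u0 s)) :=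
    fun t ht s hs => hl s (hs.trans ht.2)
  constructor
  · intro i
    choose S hS using fun m => (hsol m).1 i
    exact scal_limit hab (hA i) (hI i) (fun m s => (u m s).1 i) _ (fun m => cont_x (hu m) i)
      (cont_x hu0 i) R (fun m t ht => (abs_x _ i).trans (hR m t ht))
      (fun t ht => (((continuous_apply i).comp continuous_fst).tendsto (u0 t)).comp (hl t ht.2))
      S _ _ _ _ (K * (R + 1)) hS (fun m => upX_meas _ _ c Γ (hu m) i) (upX_meas _ _ c Γ hu0 i)
      (fun m => upX_meas _ _ c Γ (hu m) i) (upX_meas _ _ c Γ hu0 i)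
      (fun m t ht => ((hK _ hm1 _ (he m) _ (hu m) t).1 i).trans (hKm _ (hR m t ht)))
      (fun t ht => ((hK _ hm1 _ he0 _ hu0 t).1 i).trans (hKm _ (hR0 t ht)))
      (fun m t ht => ((hK _ h1 _ (he m) _ (hu m) t).1 i).trans (hKm _ (hR m t ht)))
      (fun t ht => ((hK _ h1 _ he0 _ hu0 t).1 i).trans (hKm _ (hR0 t ht)))
      (fun t ht => (up_lim _ he he0 h c d Γ hu hu0 t (hlt t ht)).1 i)
      (fun t ht => (up_lim _ he he0 h c d Γ hu hu0 t (hlt t ht)).1 i)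
      (fun t ht => (up_low_le he0 c d Γ hu0 t).1 i)
  · intro i
    choose S hS using fun m => (hsol m).2 i
    exact scal_limit hab (hB i) continuous_const (fun m s => (u m s).2 i) _
      (fun m => cont_z (hu m) i)
      (cont_z hu0 i) R (fun m t ht => (abs_z _ i).trans (hR m t ht))
      (fun t ht => (((continuous_apply i).comp continuous_snd).tendsto (u0 t)).comp (hl t ht.2))
      S _ _ _ _ (K * (R + 1)) hS (fun m => upZ_meas _ _ d Γ (hu m) i) (upZ_meas _ _ d Γ hu0 i)
      (fun m => upZ_meas _ _ d Γ (hu m) i) (upZ_meas _ _ d Γ hu0 i)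
      (fun m t ht => ((hK _ hm1 _ (he m) _ (hu m) t).2 i).trans (hKm _ (hR m t ht)))
      (fun t ht => ((hK _ hm1 _ he0 _ hu0 t).2 i).trans (hKm _ (hR0 t ht)))
      (fun m t ht => ((hK _ h1 _ (he m) _ (hu m) t).2 i).trans (hKm _ (hR m t ht)))
      (fun t ht => ((hK _ h1 _ he0 _ hu0 t).2 i).trans (hKm _ (hR0 t ht)))
      (fun t ht => (up_lim _ he he0 h c d Γ hu hu0 t (hlt t ht)).2 i)
      (fun t ht => (up_lim _ he he0 h c d Γ hu hu0 t (hlt t ht)).2 i)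
      (fun t ht => (up_low_le he0 c d Γ hu0 t).2 i)

end

/-- convergence of solutions of the `ε_m`-inflated inclusions to a
solution of the `ε₀`-inflated inclusion. -/
theorem stmt12 {n : ℕ} (hn : 2 ≤ n) (γ α : ℝ) (hγ : 0 < γ)
    (A : Fin n → ℝ → ℝ) (B : IdxZ n → ℝ → ℝ) (μ : IdxZ n → Measure ℝ)
    (c d : IdxZ n → ℝ) (Γ : Fin n → ℝ) (Istim : Fin n → ℝ → ℝ)
    (hD : HypD α A B) (hM : HypM γ μ) (hI : HypI Istim)
    (hc : ∀ p, 0 ≤ c p) (hd : ∀ p, 0 ≤ d p)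
    (T r : ℝ) (hT : 0 < T) (hr : 0 < r)
    (ε : ℕ → ℝ) (hεr : ∀ m, ε m ∈ Icc (0 : ℝ) (1 / 5))
    (ε₀ : ℝ) (hε₀ : ε₀ ∈ Icc (0 : ℝ) (1 / 5))
    (hanti : Antitone ε) (hεlim : Tendsto ε atTop (𝓝 ε₀))
    (t₀ : ℝ) (u₀m : ℕ → ℝ → NState n) (u₀ : ℝ → NState n)
    (hu₀m : ∀ m, InC γ (u₀m m)) (hu₀ : InC γ u₀)
    (hbdd : ∀ m, gNorm γ (u₀m m) ≤ r)
    (hconv : Tendsto (fun m => gNorm γ (fun s => u₀m m s - u₀ s)) atTop (𝓝 0))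
    (u : ℕ → ℝ → NState n)
    (hsol : ∀ m, IsIncSolOn (ε m) A B μ c d Γ Istim t₀ (t₀ + T) (u₀m m) (u m)) :
    ∃ φ : ℕ → ℕ, StrictMono φ ∧ ∃ ustar : ℝ → NState n,
      TendstoUniformlyOn (fun k => u (φ k)) ustar atTop (Icc t₀ (t₀ + T)) ∧
      ContinuousOn ustar (Icc t₀ (t₀ + T)) ∧
      IsIncSolOn ε₀ A B μ c d Γ Istim t₀ (t₀ + T) u₀
        (fun t => if t ≤ t₀ then u₀ (t - t₀) else ustar t) := by

  haveI hfin : ∀ p, IsFiniteMeasure ((μ p).restrict (Iic (0 : ℝ))) := hypM_fin hγ hM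
  have hA : ∀ i, Continuous (A i) := fun i => (hD.2.1 i).1.continuous
  have hB : ∀ i, Continuous (B i) := fun i => (hD.2.2 i).1.continuous
  have hA0 : ∀ i s, 0 ≤ A i s := fun i s => hD.1.le.trans ((hD.2.1 i).2 s)
  have hB0 : ∀ i s, 0 ≤ B i s := fun i s => hD.1.le.trans ((hD.2.2 i).2 s)
  have hab : t₀ ≤ t₀ + T := by linarith
  have hua : ∀ m, u m t₀ = u₀m m 0 := fun m => by
    have := (hsol m).1 0 le_rfl
    rwa [add_zero] at this
  -- continuous global representatives
  let w : ℕ → ℝ → NState n := fun m t =>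
    if t ≤ t₀ then u₀m m (t - t₀) else IccExtend hab (fun s : Icc t₀ (t₀ + T) => u m s.1) t
  have hwE : ∀ m, Continuous (IccExtend hab (fun s : Icc t₀ (t₀ + T) => u m s.1)) := fun m =>
    (continuousOn_iff_continuous_restrict.1 (hsol m).2.1).Icc_extend'
  have hw : ∀ m, Continuous (w m) := fun m => by
    refine glue_cont (hu₀m m).1 (hwE m).continuousOn ?_
    rw [IccExtend_of_mem hab _ ⟨le_rfl, hab⟩, hua m]
  have huw : ∀ m, ∀ t ≤ t₀ + T, u m t = w m t := fun m t ht => by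
    by_cases h : t ≤ t₀
    · simp only [w, if_pos h]
      rw [← (hsol m).1 (t - t₀) (by linarith)]
      congr 1
      ring
    · simp only [w, if_neg h]
      rw [IccExtend_of_mem hab _ ⟨(not_le.1 h).le, ht⟩]
  have hcs : ∀ m, CompSol (ε m) A B μ c d Γ Istim t₀ (t₀ + T) (w m) := fun m =>
    fwd hA hB hI c d Γ (hεr m) (hw m) (huw m) (hsol m)
  have hwa : ∀ m, ‖w m t₀‖ ≤ r := fun m => by
    rw [← huw m t₀ hab, hua m]
    have := gNorm_pt (hu₀m m).2.2 (le_refl (0 : ℝ))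
    rw [mul_zero, Real.exp_zero, one_mul] at this
    exact this.trans (hbdd m)
  obtain ⟨R, L, hR0, hL0, hRL⟩ := comp_bound (μ := μ) hA hB hA0 hB0 hI c d Γ (a := t₀)
    (b := t₀ + T) hr.le
  obtain ⟨φ, hφ, g, hg, hgu⟩ := arz hab w R L hL0
    (fun m => (hRL _ (hεr m) _ (hw m) (hwa m) (hcs m)).1)
    (fun m => (hRL _ (hεr m) _ (hw m) (hwa m) (hcs m)).2)
  have hpt : ∀ s ≤ (0 : ℝ), Tendsto (fun m => u₀m m s) atTop (𝓝 (u₀ s)) := fun s hs =>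
    gconv (fun m => (hu₀m m).2.2) hu₀.2.2 hconv hs
  have hg0 : u₀ 0 = g t₀ := by
    refine tendsto_nhds_unique ((hpt 0 le_rfl).comp hφ.tendsto_atTop) ?_
    refine (hgu.tendsto_at ⟨le_rfl, hab⟩).congr fun k => ?_
    rw [← huw _ _ hab, hua]
    rfl
  have hlc : Continuous fun t => if t ≤ t₀ then u₀ (t - t₀) else g t :=
    glue_cont hu₀.1 hg.continuousOn hg0
  refine ⟨φ, hφ, g, ?_, hg.continuousOn, ?_⟩
  · refine hgu.congr (Eventually.of_forall fun k t ht => ?_)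
    exact (huw _ t ht.2).symm
  · refine bwd hA hB hI c d Γ hε₀ hlc (fun s hs => ?_) ?_
    · simp [hs]
    · refine comp_limit hA hB hI c d Γ hab (fun k => hεr (φ k)) hε₀ (hεlim.comp hφ.tendsto_atTop)
        (fun k => hw (φ k)) hlc
        (fun k => (hRL _ (hεr (φ k)) _ (hw (φ k)) (hwa (φ k)) (hcs (φ k))).1) (fun s hs => ?_)
        (fun k => hcs (φ k))
      by_cases h : s ≤ t₀
      · simp only [w, if_pos h]
        exact (hpt (s - t₀) (by linarith)).comp hφ.tendsto_atTop
      · rw [if_neg h]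
        exact hgu.tendsto_at ⟨(not_le.1 h).le, hs⟩

end
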